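/- arXiv:2412.14936 — 17 statements merged into one kernel-verified Lean document; each statement's English description precedes it below -/
import Mathlib

section
/- If G is a finite simple graph with n vertices, average degree d, minimum degree at least δ, and maximum degree at most Δ, where 0 ≤ δ < d < Δ < n, then the degree deviation satisfies s(G) ≤ 2n(Δ−d)(d−δ)/(Δ−δ). -/
/-- If `G` is a finite simple graph with `n` vertices, average degree `d`,
minimum degree at least `δ`, and maximum degree at most `Δ`, where `0 ≤ δ < d < Δ < n`,
then the degree deviation `s(G) = ∑ u, |deg u - d|` satisfies
`s(G) ≤ 2n(Δ−d)(d−δ)/(Δ−δ)`. -/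
theorem degree_deviation_upper_bound
    {V : Type*} [Fintype V] [DecidableEq V] (G : SimpleGraph V) [DecidableRel G.Adj]
    (n d δ Δ s : ℝ)
    (hn : n = Fintype.card V)
    (hd : d = 2 * G.edgeFinset.card / n)
    (hs : s = ∑ u : V, |(G.degree u : ℝ) - d|)
    (hδ : ∀ u : V, δ ≤ (G.degree u : ℝ))
    (hΔ : ∀ u : V, (G.degree u : ℝ) ≤ Δ)
    (h0 : 0 ≤ δ) (h1 : δ < d) (h2 : d < Δ) (h3 : Δ < n) :
    s ≤ 2 * n * (Δ - d) * (d - δ) / (Δ - δ) := by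
  have hnpos : 0 < n := by linarith
  have hsum : ∑ u : V, (G.degree u : ℝ) = n * d := by
    have h := G.sum_degrees_eq_twice_card_edges
    have h' : ∑ u : V, (G.degree u : ℝ) = 2 * G.edgeFinset.card := by exact_mod_cast h
    rw [h', hd]
    field_simp
  have key : ∀ u : V, |(G.degree u : ℝ) - d| * (Δ - δ)
      ≤ (G.degree u : ℝ) * (Δ + δ - 2 * d) + (Δ * (d - δ) - δ * (Δ - d)) := by
    intro u
    have a := mul_nonneg (sub_nonneg.2 (hΔ u)) (sub_nonneg.2 h1.le)
    have b := mul_nonneg (sub_nonneg.2 (hδ u)) (sub_nonneg.2 h2.le)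
    rcases abs_cases ((G.degree u : ℝ) - d) with ⟨h, _⟩ | ⟨h, _⟩ <;> rw [h] <;> nlinarith
  rw [le_div_iff₀ (by linarith), hs, Finset.sum_mul]
  refine (Finset.sum_le_sum fun u _ => key u).trans (le_of_eq ?_)
  rw [Finset.sum_add_distrib, ← Finset.sum_mul, hsum, Finset.sum_const, Finset.card_univ,
    nsmul_eq_mul, ← hn]
  ring
end

section
/- If G is a finite simple graph with n vertices, average degree d, and degree deviation s with s > 0, then the spectral radius satisfies: λ(G) ≥ d²n/√(d²n² − s²) whenever s ≤ dn/√2, and λ(G) ≥ 2s/n whenever s > dn/√2. -/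
/-- `l` is the largest eigenvalue (spectral radius) of the real matrix `A`. -/
def IsLargestEigenvalue {V : Type*} [Fintype V] (A : Matrix V V ℝ) (l : ℝ) : Prop :=
  (∃ v : V → ℝ, v ≠ 0 ∧ A.mulVec v = l • v) ∧
  ∀ μ : ℝ, (∃ v : V → ℝ, v ≠ 0 ∧ A.mulVec v = μ • v) → μ ≤ l

lemma aux_sq {a b : ℝ} (h : a ^ 2 ≤ b ^ 2) (hb : 0 ≤ b) : a ≤ b := abs_le_of_sq_le_sq' h hb |>.2

lemma aux_rayleigh {V : Type*} [Fintype V] [DecidableEq V] (A : Matrix V V ℝ) (hA : A.IsHermitian)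
    (l : ℝ) (h : IsLargestEigenvalue A l) (x : V → ℝ) :
    ∑ u, ∑ v, x u * A u v * x v ≤ l * ∑ u, x u ^ 2 := by
  have hB : (l • (1 : Matrix V V ℝ) - A).IsHermitian := by
    refine Matrix.IsHermitian.sub ?_ hA
    simp [Matrix.IsHermitian]
  have hp : (l • (1 : Matrix V V ℝ) - A).PosSemidef := by
    rw [hB.posSemidef_iff_eigenvalues_nonneg]
    intro i
    have h1 := hB.mulVec_eigenvectorBasis i
    have h0 : (hB.eigenvectorBasis i).ofLp ≠ 0 := by
      intro h0
      have := hB.eigenvectorBasis.orthonormal.ne_zero i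
      apply this
      ext j
      exact congrFun h0 j
    have := h.2 (l - hB.eigenvalues i) ⟨_, h0, by
      rw [Matrix.sub_mulVec, Matrix.smul_mulVec, Matrix.one_mulVec] at h1
      rw [sub_smul, ← h1]; abel⟩
    simp only [Pi.zero_apply]
    linarith
  have := hp.dotProduct_mulVec_nonneg x
  rw [Matrix.sub_mulVec, Matrix.smul_mulVec, Matrix.one_mulVec] at this
  simp only [dotProduct, Matrix.mulVec, star_trivial, Pi.sub_apply, Pi.smul_apply, smul_eq_mul,
    mul_sub, Finset.sum_sub_distrib, Finset.mul_sum] at this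
  rw [Finset.mul_sum]
  have e1 : ∑ u, l * x u ^ 2 = ∑ u, x u * (l * x u) := Finset.sum_congr rfl fun _ _ => by ring
  have e2 : ∑ u, ∑ v, x u * A u v * x v = ∑ u, ∑ v, x u * (A u v * x v) :=
    Finset.sum_congr rfl fun _ _ => Finset.sum_congr rfl fun _ _ => by ring
  rw [e1, e2]; linarith

lemma aux_real (n d s l a b c eA eB : ℝ) (hn : 0 < n) (hd : 0 < d) (hs : 0 < s) (ha : 0 ≤ a)
    (hab : a + b = n) (hA : 0 ≤ eA) (hB : 0 ≤ eB)
    (h1 : eA + c = a * d + s / 2) (h2 : eB + c = b * d - s / 2)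
    (hq : ∀ α β : ℝ, α ^ 2 * eA + 2 * (α * β) * c + β ^ 2 * eB ≤ l * (α ^ 2 * a + β ^ 2 * b)) :
    (2 * s ^ 2 ≤ d ^ 2 * n ^ 2 → d ^ 4 * n ^ 2 ≤ l ^ 2 * (d ^ 2 * n ^ 2 - s ^ 2)) ∧
    2 * s ≤ l * n ∧ d ≤ l := by
  have hl : d ≤ l := by
    have := hq 1 1
    have h3 : d * n ≤ l * n := by subst hab; linarith
    exact le_of_mul_le_mul_right h3 hn
  have hdet : c ^ 2 ≤ (l * a - eA) * (l * b - eB) := by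
    have := discrim_le_zero (a := l * a - eA) (b := -2 * c) (c := l * b - eB) (fun x => by
      have := hq x 1
      nlinarith)
    unfold discrim at this
    nlinarith
  obtain ⟨t, rfl⟩ : ∃ t, l = d + t := ⟨l - d, by ring⟩
  have ht : 0 ≤ t := by linarith
  obtain ⟨z, hz⟩ : ∃ z, z = b - a := ⟨_, rfl⟩
  obtain rfl : b = (n + z) / 2 := by linarith
  obtain rfl : a = (n - z) / 2 := by linarith
  obtain rfl : eA = (n - z) / 2 * d + s / 2 - c := by linarith
  obtain rfl : eB = (n + z) / 2 * d - s / 2 - c := by linarith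
  have hD : s ^ 2 / 4 + t * s * z / 2 - t ^ 2 * (n ^ 2 - z ^ 2) / 4 ≤ t * n * c := by
    linarith
  have htn : 0 ≤ t * n := by positivity
  obtain ⟨w, rfl⟩ : ∃ w, s = d * w := ⟨s / d, by field_simp⟩
  have hw : 0 < w := pos_of_mul_pos_right hs hd.le
  -- main bound
  have fin1 : (d * w) ^ 2 ≤ ((d + t) ^ 2 - d ^ 2) * (n ^ 2 - w ^ 2) →
      d ^ 4 * n ^ 2 ≤ (d + t) ^ 2 * (d ^ 2 * n ^ 2 - (d * w) ^ 2) := by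
    intro h
    have := mul_le_mul_of_nonneg_left h (sq_nonneg d)
    linarith
  rcases le_total z w with hzw | hzw
  · have hC : (d * w) ^ 2 ≤ t ^ 2 * (n ^ 2 - z ^ 2) + 2 * t * (n + z) * (d * n - d * w) := by
      have := mul_le_mul_of_nonneg_left hB htn
      linarith
    refine ⟨fun h => ?_, ?_, hl⟩
    · by_contra hcon
      push Not at hcon
      have h5 : (d + t) * w ≤ d * n := by
        have hww : w ^ 2 ≤ n ^ 2 - w ^ 2 := by
          have : d ^ 2 * (w ^ 2) ≤ d ^ 2 * (n ^ 2 - w ^ 2) := by nlinarith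
          exact le_of_mul_le_mul_left this (by positivity)
        have h6 : d ^ 2 * ((d + t) * w) ^ 2 ≤ d ^ 2 * (d * n) ^ 2 := by
          have := mul_le_mul_of_nonneg_left hww (by positivity : 0 ≤ d ^ 2 * (d + t) ^ 2)
          nlinarith
        have h7 := le_of_mul_le_mul_left h6 (by positivity)
        exact aux_sq h7 (by positivity)
      apply absurd (fin1 ?_) (not_le.mpr hcon)
      have h8 : 0 ≤ t * (w - z) * (2 * (d * n - d * w) - t * (w + z)) := by
        apply mul_nonneg (mul_nonneg ht (by linarith))
        nlinarith
      linarith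
    · have h9 : (d * w) ^ 2 ≤ (t * n + (d * n - d * w)) ^ 2 := by
        linarith [sq_nonneg (t * z - (d * n - d * w))]
      rcases le_or_gt 0 (t * n + (d * n - d * w)) with h | h
      · have := aux_sq h9 h
        linarith
      · exfalso
        have : 0 < d * n := by positivity
        nlinarith
  · have hC : (d * w) ^ 2 ≤ t ^ 2 * (n ^ 2 - z ^ 2) + 2 * t * (n - z) * (d * n + d * w) := by
      have := mul_le_mul_of_nonneg_left hA htn
      linarith
    have h8 : (d * w) ^ 2 ≤ ((d + t) ^ 2 - d ^ 2) * (n ^ 2 - w ^ 2) := by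
      have : 0 ≤ t * (z - w) * (2 * (d * n + d * w) + t * (w + z)) := by
        apply mul_nonneg (mul_nonneg ht (by linarith))
        have : 0 ≤ w + z := by linarith
        positivity
      linarith
    have h10 := fin1 h8
    refine ⟨fun _ => h10, ?_, hl⟩
    have hK : 0 < d ^ 2 * n ^ 2 - (d * w) ^ 2 := by
      by_contra hc
      have : 0 < d ^ 4 * n ^ 2 := by positivity
      have := mul_nonneg (sq_nonneg (d + t)) (by linarith : 0 ≤ -(d ^ 2 * n ^ 2 - (d * w) ^ 2))
      linarith
    have h11 : (d ^ 2 * n ^ 2 - (d * w) ^ 2) * (2 * (d * w)) ^ 2 ≤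
        (d ^ 2 * n ^ 2 - (d * w) ^ 2) * ((d + t) * n) ^ 2 := by
      have := mul_le_mul_of_nonneg_left h10 (sq_nonneg n)
      linarith [sq_nonneg (d ^ 2 * n ^ 2 - 2 * (d * w) ^ 2)]
    exact aux_sq (le_of_mul_le_mul_left h11 hK) (by positivity)

/-- If `G` is a finite simple graph with `n` vertices, average degree `d`,
and degree deviation `s > 0`, then the spectral radius `λ(G)` satisfies
`λ(G) ≥ d²n/√(d²n² − s²)` whenever `s ≤ dn/√2`, and `λ(G) ≥ 2s/n` whenever `s > dn/√2`. -/
theorem spectral_radius_lower_bound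
    {V : Type*} [Fintype V] [DecidableEq V] (G : SimpleGraph V) [DecidableRel G.Adj]
    (n d s lam : ℝ)
    (hn : n = Fintype.card V)
    (hd : d = 2 * G.edgeFinset.card / n)
    (hs : s = ∑ u : V, |(G.degree u : ℝ) - d|)
    (hlam : IsLargestEigenvalue (G.adjMatrix ℝ) lam)
    (hspos : 0 < s) :
    (s ≤ d * n / Real.sqrt 2 → lam ≥ d ^ 2 * n / Real.sqrt (d ^ 2 * n ^ 2 - s ^ 2)) ∧
    (s > d * n / Real.sqrt 2 → lam ≥ 2 * s / n) := by
  have hn0 : 0 < n := by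
    rw [hn]
    have : Nonempty V := by
      by_contra hne
      rw [not_nonempty_iff] at hne
      simp [hs] at hspos
    exact_mod_cast Fintype.card_pos
  have hdeg : ∑ u, (G.degree u : ℝ) = d * n := by
    rw [hd, div_mul_cancel₀ _ hn0.ne']
    exact_mod_cast G.sum_degrees_eq_twice_card_edges
  have hd0 : 0 < d := by
    have h0 : 0 ≤ d := by rw [hd]; positivity
    rcases h0.eq_or_lt with h | h
    · exfalso
      rw [← h] at hs hdeg
      simp only [sub_zero, Nat.abs_cast] at hs
      linarith
    · exact h
  set p : V → ℝ := fun u => if d < G.degree u then 1 else 0 with hp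
  set q : V → ℝ := fun u => 1 - p u with hqd
  have hp0 : ∀ u, 0 ≤ p u := fun u => by simp only [hp]; split_ifs <;> norm_num
  have hq0 : ∀ u, 0 ≤ q u := fun u => by simp only [hqd, hp]; split_ifs <;> norm_num
  have hpp : ∀ u, p u ^ 2 = p u := fun u => by simp only [hp]; split_ifs <;> norm_num
  have hM0 : ∀ u v, 0 ≤ G.adjMatrix ℝ u v := fun u v => by
    rw [SimpleGraph.adjMatrix_apply]; split_ifs <;> norm_num
  have hrow : ∀ u, ∑ v, G.adjMatrix ℝ u v = G.degree u := fun u => by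
    simp [SimpleGraph.adjMatrix_apply, ← SimpleGraph.card_neighborFinset_eq_degree, SimpleGraph.neighborFinset_eq_filter]
  have hsym : ∀ u v, G.adjMatrix ℝ u v = G.adjMatrix ℝ v u := fun u v => by
    simp [SimpleGraph.adjMatrix_apply, G.adj_comm]
  set M := G.adjMatrix ℝ with hM
  have hcs : ∑ u, ∑ v, q u * M u v * p v = ∑ u, ∑ v, p u * M u v * q v := by
    rw [Finset.sum_comm]
    exact Finset.sum_congr rfl fun u _ => Finset.sum_congr rfl fun v _ => by rw [hsym v u]; ring
  have hPdeg : ∑ u, p u * G.degree u = (∑ u, p u) * d + s / 2 := by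
    have e : s = ∑ u, (2 * (p u * G.degree u) - 2 * d * p u - (G.degree u - d)) := by
      rw [hs]
      refine Finset.sum_congr rfl fun u _ => ?_
      simp only [hp]
      split_ifs with h
      · rw [abs_of_pos (by linarith)]; ring
      · rw [abs_of_nonpos (by linarith)]; ring
    simp only [Finset.sum_sub_distrib, ← Finset.mul_sum, hdeg, Finset.sum_const, Finset.card_univ,
      nsmul_eq_mul, ← hn] at e
    linarith
  have hQdeg : ∑ u, q u * G.degree u = (∑ u, q u) * d - s / 2 := by
    simp only [hqd, sub_mul, one_mul, Finset.sum_sub_distrib, hPdeg, hdeg, Finset.sum_const,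
      Finset.card_univ, nsmul_eq_mul, ← hn]
    ring
  have key := aux_real n d s lam (∑ u, p u) (∑ u, q u) (∑ u, ∑ v, p u * M u v * q v)
    (∑ u, ∑ v, p u * M u v * p v) (∑ u, ∑ v, q u * M u v * q v) hn0 hd0 hspos
    (Finset.sum_nonneg fun u _ => hp0 u)
    (by simp [← Finset.sum_add_distrib, hqd, hn])
    (Finset.sum_nonneg fun u _ => Finset.sum_nonneg fun v _ =>
      mul_nonneg (mul_nonneg (hp0 u) (hM0 u v)) (hp0 v))
    (Finset.sum_nonneg fun u _ => Finset.sum_nonneg fun v _ =>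
      mul_nonneg (mul_nonneg (hq0 u) (hM0 u v)) (hq0 v))
    (by
      rw [← hPdeg, ← Finset.sum_add_distrib]
      refine Finset.sum_congr rfl fun u _ => ?_
      rw [← Finset.sum_add_distrib, ← hrow, Finset.mul_sum]
      refine Finset.sum_congr rfl fun v _ => ?_
      simp only [hqd]; ring)
    (by
      rw [← hQdeg, ← hcs, ← Finset.sum_add_distrib]
      refine Finset.sum_congr rfl fun u _ => ?_
      rw [← Finset.sum_add_distrib, ← hrow, Finset.mul_sum]
      refine Finset.sum_congr rfl fun v _ => ?_
      simp only [hqd]; ring)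
    (fun α β => by
      have h := aux_rayleigh M (by
        ext u v; simp [Matrix.conjTranspose_apply, hsym v u]) lam hlam (fun u => α * p u + β * q u)
      have e1 : ∑ u, (α * p u + β * q u) ^ 2 = α ^ 2 * ∑ u, p u + β ^ 2 * ∑ u, q u := by
        rw [Finset.mul_sum, Finset.mul_sum, ← Finset.sum_add_distrib]
        refine Finset.sum_congr rfl fun u _ => ?_
        have := hpp u
        simp only [hqd]
        linear_combination (α ^ 2 + β ^ 2 - 2 * α * β) * this
      have e2 : ∑ u, ∑ v, (α * p u + β * q u) * M u v * (α * p v + β * q v) =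
          α ^ 2 * (∑ u, ∑ v, p u * M u v * p v) + α * β * (∑ u, ∑ v, p u * M u v * q v)
          + α * β * (∑ u, ∑ v, q u * M u v * p v) + β ^ 2 * (∑ u, ∑ v, q u * M u v * q v) := by
        simp only [Finset.mul_sum, ← Finset.sum_add_distrib]
        refine Finset.sum_congr rfl fun u _ => Finset.sum_congr rfl fun v _ => ?_
        ring
      rw [e1, e2, hcs] at h
      linarith)
  obtain ⟨k1, k2, k3⟩ := key
  refine ⟨fun h => ?_, fun _ => ?_⟩
  · have h2 : 2 * s ^ 2 ≤ d ^ 2 * n ^ 2 := by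
      rw [le_div_iff₀ (by positivity)] at h
      have := pow_le_pow_left₀ (by positivity) h 2
      rw [mul_pow, Real.sq_sqrt (by norm_num)] at this
      linarith
    have hK : 0 < d ^ 2 * n ^ 2 - s ^ 2 := by
      have : 0 < s ^ 2 := by positivity
      linarith
    rw [ge_iff_le, div_le_iff₀ (Real.sqrt_pos.mpr hK)]
    have hl0 : 0 < lam := by linarith
    refine aux_sq ?_ (by positivity)
    rw [mul_pow lam, Real.sq_sqrt hK.le]
    have := k1 h2
    linarith
  · rw [ge_iff_le, div_le_iff₀ hn0]
    exact k2
end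

section
/- If G is a finite simple graph with n vertices, average degree d, and maximum degree at most Δ, where 0 < d < Δ < n, d ≤ n−3, and 2Δ ≤ dn < Δ(Δ+1), then s(G) ≤ max{ (2Δ+1 − √((2Δ+1)² − 4dn))(Δ−d), d(2n−1 − √(4dn+1)) }. -/
theorem dd_comb {V : Type*} [Fintype V] [DecidableEq V] (G : SimpleGraph V) [DecidableRel G.Adj]
    (A : Finset V) :
    2 * (∑ u ∈ A, (G.degree u : ℝ)) ≤ ∑ u, (G.degree u : ℝ) + A.card * (A.card - 1) := by
  have hdeg : ∀ u, (G.degree u : ℝ) =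
      ∑ v ∈ A, (if G.Adj u v then (1:ℝ) else 0) + ∑ v ∈ Aᶜ, (if G.Adj u v then (1:ℝ) else 0) := by
    intro u
    rw [Finset.sum_add_sum_compl, Finset.sum_boole, ← G.card_neighborFinset_eq_degree,
      G.neighborFinset_eq_filter]
  have hnn : ∀ u v, (0:ℝ) ≤ (if G.Adj u v then (1:ℝ) else 0) := by
    intro u v; split_ifs <;> norm_num
  have hin : ∑ u ∈ A, ∑ v ∈ A, (if G.Adj u v then (1:ℝ) else 0) ≤ A.card * (A.card - 1) := by
    have : ∀ u ∈ A, ∑ v ∈ A, (if G.Adj u v then (1:ℝ) else 0) ≤ (A.card : ℝ) - 1 := by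
      intro u hu
      rw [← Finset.add_sum_erase A _ hu]
      have h1 : ∑ v ∈ A.erase u, (if G.Adj u v then (1:ℝ) else 0) ≤ ∑ v ∈ A.erase u, (1:ℝ) := by
        apply Finset.sum_le_sum
        intro v _
        split_ifs <;> norm_num
      have h2 : ((A.erase u).card : ℝ) + 1 = A.card := by
        exact_mod_cast Finset.card_erase_add_one hu
      simp only [Finset.sum_const, nsmul_eq_mul, mul_one] at h1
      simp only [SimpleGraph.irrefl, if_false]
      linarith
    calc _ ≤ ∑ u ∈ A, ((A.card : ℝ) - 1) := Finset.sum_le_sum this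
      _ = _ := by rw [Finset.sum_const, nsmul_eq_mul]
  have hout : ∑ u ∈ A, ∑ v ∈ Aᶜ, (if G.Adj u v then (1:ℝ) else 0) ≤
      ∑ v ∈ Aᶜ, (G.degree v : ℝ) := by
    rw [Finset.sum_comm]
    apply Finset.sum_le_sum
    intro v _
    rw [hdeg v]
    have : ∑ w ∈ A, (if G.Adj w v then (1:ℝ) else 0) = ∑ w ∈ A, (if G.Adj v w then (1:ℝ) else 0) := by
      apply Finset.sum_congr rfl
      intro w _
      simp only [G.adj_comm]
    rw [this]
    have := Finset.sum_nonneg (s := Aᶜ) (fun w _ => hnn v w)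
    linarith
  have hA : ∑ u ∈ A, (G.degree u : ℝ) = ∑ u ∈ A, ∑ v ∈ A, (if G.Adj u v then (1:ℝ) else 0) +
      ∑ u ∈ A, ∑ v ∈ Aᶜ, (if G.Adj u v then (1:ℝ) else 0) := by
    rw [← Finset.sum_add_distrib]
    exact Finset.sum_congr rfl fun u _ => hdeg u
  have htot := Finset.sum_add_sum_compl A (fun u => (G.degree u : ℝ))
  linarith

theorem dd_num (n d Δ s k : ℝ) (h0 : 0 < d) (h1 : d < Δ)
    (h5 : d * n < Δ * (Δ + 1)) (hnn : 0 ≤ d * n)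
    (b1 : s ≤ 2 * k * (Δ - d)) (b2 : s ≤ d * n + k * (k - 1) - 2 * k * d)
    (b3 : s ≤ 2 * d * (n - k)) :
    s ≤ max ((2 * Δ + 1 - Real.sqrt ((2 * Δ + 1) ^ 2 - 4 * d * n)) * (Δ - d))
            (d * (2 * n - 1 - Real.sqrt (4 * d * n + 1))) := by
  have hx := Real.sq_sqrt (show 0 ≤ (2 * Δ + 1) ^ 2 - 4 * d * n by nlinarith)
  have hy := Real.sq_sqrt (show 0 ≤ 4 * d * n + 1 by nlinarith)
  generalize Real.sqrt ((2 * Δ + 1) ^ 2 - 4 * d * n) = x at *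
  generalize Real.sqrt (4 * d * n + 1) = y at *
  obtain ⟨p, hp⟩ : ∃ p, p = (2 * Δ + 1 - x) / 2 := ⟨_, rfl⟩
  obtain ⟨q, hq⟩ : ∃ q, q = (1 + y) / 2 := ⟨_, rfl⟩
  have ex : x = 2 * Δ + 1 - 2 * p := by linarith
  have ey : y = 2 * q - 1 := by linarith
  subst ex ey
  rw [le_max_iff]
  rcases le_total k p with hk | hk
  · left; nlinarith [mul_nonneg (sub_nonneg.2 hk) (sub_pos.2 h1).le]
  rcases le_total q k with hk2 | hk2
  · right; nlinarith [mul_nonneg (sub_nonneg.2 hk2) h0.le]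
  have hc := mul_nonneg (sub_nonneg.2 hk) (sub_nonneg.2 hk2)
  rcases le_total 0 (p + q - 1 - 2 * d) with hh | hh
  · right; nlinarith [mul_nonneg hh (sub_nonneg.2 hk2)]
  · left; nlinarith [mul_nonneg (sub_nonneg.2 hh) (sub_nonneg.2 hk)]

/-- If `G` is a finite simple graph with `n` vertices, average degree `d`,
and maximum degree at most `Δ`, where `0 < d < Δ < n`, `d ≤ n−3`, and `2Δ ≤ dn < Δ(Δ+1)`,
then `s(G) ≤ max{(2Δ+1 − √((2Δ+1)² − 4dn))(Δ−d), d(2n−1 − √(4dn+1))}`. -/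
theorem degree_deviation_upper_bound_delta_zero
    {V : Type*} [Fintype V] [DecidableEq V] (G : SimpleGraph V) [DecidableRel G.Adj]
    (n d Δ s : ℝ)
    (hn : n = Fintype.card V)
    (hd : d = 2 * G.edgeFinset.card / n)
    (hs : s = ∑ u : V, |(G.degree u : ℝ) - d|)
    (hΔ : ∀ u : V, (G.degree u : ℝ) ≤ Δ)
    (h0 : 0 < d) (h1 : d < Δ) (h2 : Δ < n)
    (h3 : d ≤ n - 3) (h4 : 2 * Δ ≤ d * n) (h5 : d * n < Δ * (Δ + 1)) :
    s ≤ max ((2 * Δ + 1 - Real.sqrt ((2 * Δ + 1) ^ 2 - 4 * d * n)) * (Δ - d))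
            (d * (2 * n - 1 - Real.sqrt (4 * d * n + 1))) := by
  have hn0 : n ≠ 0 := by
    rintro rfl
    simp at hd
    linarith
  have hsum : ∑ u, (G.degree u : ℝ) = d * n := by
    have h := G.sum_degrees_eq_twice_card_edges
    have h' : ∑ u, (G.degree u : ℝ) = 2 * G.edgeFinset.card := by exact_mod_cast h
    rw [h', hd]; field_simp
  let A : Finset V := Finset.univ.filter fun u => d < (G.degree u : ℝ)
  have hS : s = 2 * (∑ u ∈ A, (G.degree u : ℝ) - A.card * d) := by
    have e1 := Finset.sum_add_sum_compl A (fun u => |(G.degree u : ℝ) - d|)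
    have e2 := Finset.sum_add_sum_compl A (fun u => (G.degree u : ℝ) - d)
    have e3 : ∑ u ∈ A, |(G.degree u : ℝ) - d| = ∑ u ∈ A, ((G.degree u : ℝ) - d) := by
      apply Finset.sum_congr rfl
      intro u hu
      have : d < (G.degree u : ℝ) := (Finset.mem_filter.1 hu).2
      exact abs_of_pos (by linarith)
    have e4 : ∑ u ∈ Aᶜ, |(G.degree u : ℝ) - d| = - ∑ u ∈ Aᶜ, ((G.degree u : ℝ) - d) := by
      rw [← Finset.sum_neg_distrib]
      apply Finset.sum_congr rfl
      intro u hu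
      have : ¬ d < (G.degree u : ℝ) := fun h =>
        (Finset.mem_compl.1 hu) (Finset.mem_filter.2 ⟨Finset.mem_univ _, h⟩)
      exact abs_of_nonpos (by linarith)
    have e5 : ∑ u, ((G.degree u : ℝ) - d) = 0 := by
      rw [Finset.sum_sub_distrib, hsum]
      simp [hn, mul_comm]
    have e6 : ∑ u ∈ A, ((G.degree u : ℝ) - d) = ∑ u ∈ A, (G.degree u : ℝ) - A.card * d := by
      rw [Finset.sum_sub_distrib]; simp
    linarith
  have c1 := dd_comb G A
  have c2 : ∑ u ∈ A, (G.degree u : ℝ) ≤ A.card * Δ := by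
    have := Finset.sum_le_card_nsmul A (fun u => (G.degree u : ℝ)) Δ (fun u _ => hΔ u)
    simpa using this
  have c3 : ∑ u ∈ A, (G.degree u : ℝ) ≤ ∑ u, (G.degree u : ℝ) :=
    Finset.sum_le_sum_of_subset_of_nonneg (Finset.subset_univ _) (fun u _ _ => by positivity)
  have hnn : 0 ≤ d * n := by rw [← hsum]; positivity
  rw [hsum] at c1 c3
  exact dd_num n d Δ s A.card h0 h1 h5 hnn (by linarith) (by linarith) (by linarith)
end

section
/- If G is a finite simple graph with n vertices, average degree d, and degree deviation s with s > 0, then λ(G) ≥ d + √2·s²/(2n²√(dn)). -/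
lemma rayleigh_aux {V : Type*} [Fintype V] [DecidableEq V] (A : Matrix V V ℝ)
    (hA : A.IsHermitian) (l : ℝ) (h : IsLargestEigenvalue A l) (x : V → ℝ) :
    ∑ i, ∑ j, x i * A i j * x j ≤ l * ∑ i, x i ^ 2 := by
  have hB : (l • (1 : Matrix V V ℝ) - A).IsHermitian := by
    apply Matrix.IsHermitian.sub _ hA
    ext i j
    simp [Matrix.one_apply, eq_comm]
  have hP : (l • (1 : Matrix V V ℝ) - A).PosSemidef := by
    rw [hB.posSemidef_iff_eigenvalues_nonneg]
    intro i
    have h1 := hB.mulVec_eigenvectorBasis i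
    have h2 := h.2 (l - hB.eigenvalues i) ⟨⇑(hB.eigenvectorBasis i), ?_, ?_⟩
    · simp only [Pi.zero_apply]; linarith
    · intro h0
      apply hB.eigenvectorBasis.orthonormal.ne_zero i
      ext j
      exact congrFun h0 j
    · rw [Matrix.sub_mulVec, Matrix.smul_mulVec, Matrix.one_mulVec] at h1
      rw [sub_smul, ← h1]
      simp
  have h3 := hP.dotProduct_mulVec_nonneg x
  rw [Matrix.sub_mulVec, Matrix.smul_mulVec, Matrix.one_mulVec, dotProduct_sub] at h3
  simp only [dotProduct, Matrix.mulVec, star_trivial, Pi.smul_apply, smul_eq_mul] at h3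
  have e1 : ∑ i, x i * (l * x i) = l * ∑ i, x i ^ 2 := by
    rw [Finset.mul_sum]; exact Finset.sum_congr rfl fun i _ => by ring
  have e2 : ∑ i, x i * ∑ j, A i j * x j = ∑ i, ∑ j, x i * A i j * x j := by
    refine Finset.sum_congr rfl fun i _ => ?_
    rw [Finset.mul_sum]; exact Finset.sum_congr rfl fun j _ => by ring
  linarith

lemma core_aux {V : Type*} [Fintype V] (a : V → V → ℝ) (f : V → ℝ) (n d s lam : ℝ)
    (hn : n = Fintype.card V) (hnpos : 0 < n)
    (hsymm : ∀ i j, a i j = a j i)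
    (hrow : ∀ i, ∑ j, a i j = d + f i)
    (hf : ∑ i, f i = 0)
    (hsq : ∑ i, ∑ j, a i j ^ 2 = d * n)
    (hs : s = ∑ i, |f i|) (hspos : 0 < s)
    (hR : ∀ x : V → ℝ, ∑ i, ∑ j, x i * a i j * x j ≤ lam * ∑ i, x i ^ 2) :
    lam ≥ d + Real.sqrt 2 * s ^ 2 / (2 * n ^ 2 * Real.sqrt (d * n)) := by
  obtain ⟨F, hF⟩ : ∃ F, F = ∑ i, f i ^ 2 := ⟨_, rfl⟩
  obtain ⟨Q, hQ⟩ : ∃ Q, Q = ∑ i, ∑ j, f i * a i j * f j := ⟨_, rfl⟩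
  have hsF : s ^ 2 ≤ n * F := by
    have := sq_sum_le_card_mul_sum_sq (s := Finset.univ) (f := fun i => |f i|)
    simpa [hs, hF, hn] using this
  have hFpos : 0 < F := by
    by_contra hc
    nlinarith [mul_nonneg hnpos.le (not_lt.mp hc |> neg_nonneg.mpr), pow_pos hspos 2]
  obtain ⟨W, hW⟩ : ∃ W, W = F / n := ⟨_, rfl⟩
  obtain ⟨ν, hν⟩ : ∃ ν, ν = Q / F := ⟨_, rfl⟩
  have hFW : F = n * W := by rw [hW]; field_simp
  have hQν : Q = ν * F := by rw [hν]; field_simp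
  have hWpos : 0 < W := by rw [hW]; positivity
  -- basic sums
  have s1 : ∑ i, ∑ j, a i j = d * n := by
    simp only [hrow, Finset.sum_add_distrib, hf]
    simp [hn, mul_comm]
  have s2 : ∑ i, ∑ j, f i * a i j = F := by
    simp only [← Finset.mul_sum, hrow, mul_add, Finset.sum_add_distrib, ← Finset.sum_mul, hf]
    rw [hF]; simp [sq]
  have s3 : ∑ i, ∑ j, a i j * f j = F := by
    rw [Finset.sum_comm, ← s2]
    exact Finset.sum_congr rfl fun i _ => Finset.sum_congr rfl fun j _ => by
      rw [hsymm j i]; ring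
  -- Frobenius
  have hfrob : d ^ 2 + 2 * W + ν ^ 2 ≤ d * n := by
    have h0 : 0 ≤ ∑ i, ∑ j, (a i j - (d / n + (f i + f j) / n + ν / F * (f i * f j))) ^ 2 :=
      Finset.sum_nonneg fun i _ => Finset.sum_nonneg fun j _ => sq_nonneg _
    have e : ∑ i, ∑ j, (a i j - (d / n + (f i + f j) / n + ν / F * (f i * f j))) ^ 2
        = ∑ i, ∑ j, a i j ^ 2 - 2 * (d / n * ∑ i, ∑ j, a i j + 1 / n * ∑ i, ∑ j, f i * a i j
          + 1 / n * ∑ i, ∑ j, a i j * f j + ν / F * ∑ i, ∑ j, f i * a i j * f j)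
          + ∑ i, ∑ j, (d / n + (f i + f j) / n + ν / F * (f i * f j)) ^ 2 := by
      simp only [Finset.mul_sum, ← Finset.sum_add_distrib, ← Finset.sum_sub_distrib]
      exact Finset.sum_congr rfl fun i _ => Finset.sum_congr rfl fun j _ => by ring
    have e1 : ∀ i, ∑ j, (d / n + (f i + f j) / n + ν / F * (f i * f j)) ^ 2
        = n * (d / n + f i / n) ^ 2 + (1 / n + ν / F * f i) ^ 2 * F := by
      intro i
      have : ∀ j, (d / n + (f i + f j) / n + ν / F * (f i * f j)) ^ 2
        = (d / n + f i / n) ^ 2 + (2 * (d / n + f i / n) * (1 / n + ν / F * f i)) * f j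
          + (1 / n + ν / F * f i) ^ 2 * f j ^ 2 := fun j => by ring
      simp only [this, Finset.sum_add_distrib, ← Finset.mul_sum, hf, ← hF]
      simp [hn]
    have e2 : ∑ i, (n * (d / n + f i / n) ^ 2 + (1 / n + ν / F * f i) ^ 2 * F)
        = d ^ 2 + 2 * W + ν ^ 2 := by
      have : ∀ i, (n * (d / n + f i / n) ^ 2 + (1 / n + ν / F * f i) ^ 2 * F)
        = (n * (d / n) ^ 2 + F / n ^ 2) + (2 * n * (d / n) / n + 2 * (1 / n) * (ν / F) * F) * f i
          + (n / n ^ 2 + (ν / F) ^ 2 * F) * f i ^ 2 := fun i => by ring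
      simp only [this, Finset.sum_add_distrib, ← Finset.mul_sum, hf, ← hF]
      simp only [Finset.sum_const, Finset.card_univ, nsmul_eq_mul, ← hn, hW]
      field_simp
      ring
    rw [e, hsq, s1, s2, s3, ← hQ, Finset.sum_congr rfl fun i _ => e1 i, e2, hQν] at h0
    have e3 : d / n * (d * n) + 1 / n * F + 1 / n * F + ν / F * (ν * F)
        = d ^ 2 + 2 * W + ν ^ 2 := by
      rw [hW]; field_simp; ring
    rw [e3] at h0
    linarith
  obtain ⟨R, hRdef⟩ : ∃ R, R = Real.sqrt 2 * Real.sqrt (d * n) := ⟨_, rfl⟩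
  have hdn : 0 < d * n := by nlinarith [sq_nonneg d, sq_nonneg ν]
  have hRpos : 0 < R := by rw [hRdef]; positivity
  have hR2 : R ^ 2 = 2 * (d * n) := by
    rw [hRdef, mul_pow, Real.sq_sqrt (by norm_num), Real.sq_sqrt hdn.le]
  -- Rayleigh
  have hray : d + 2 * (1 / R) * W + (1 / R) ^ 2 * ν * W ≤ lam * (1 + (1 / R) ^ 2 * W) := by
    have h := hR (fun i => 1 + (1 / R) * f i)
    have e1 : ∑ i, ∑ j, (1 + (1 / R) * f i) * a i j * (1 + (1 / R) * f j)
        = ∑ i, ∑ j, a i j + (1 / R) * ∑ i, ∑ j, f i * a i j + (1 / R) * ∑ i, ∑ j, a i j * f j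
          + (1 / R) ^ 2 * ∑ i, ∑ j, f i * a i j * f j := by
      simp only [Finset.mul_sum, ← Finset.sum_add_distrib]
      exact Finset.sum_congr rfl fun i _ => Finset.sum_congr rfl fun j _ => by ring
    have e2 : ∑ i, (1 + (1 / R) * f i) ^ 2 = n + (1 / R) ^ 2 * F := by
      have : ∀ i, (1 + (1 / R) * f i) ^ 2 = 1 + (2 * (1 / R)) * f i + (1 / R) ^ 2 * f i ^ 2 :=
        fun i => by ring
      simp only [this, Finset.sum_add_distrib, ← Finset.mul_sum, hf, ← hF]
      simp [hn]
    rw [e1, e2, s1, s2, s3, ← hQ, hQν, hFW] at h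
    have : n * (d + 2 * (1 / R) * W + (1 / R) ^ 2 * ν * W)
        ≤ n * (lam * (1 + (1 / R) ^ 2 * W)) := by linarith
    exact le_of_mul_le_mul_left this hnpos
  have hkey : W ≤ R * (R - (d - ν)) := by
    nlinarith [sq_nonneg (R - (d - ν)), sq_nonneg (d + ν)]
  have hfin : d + W / R ≤ lam := by
    have hp : 0 < 1 + (1 / R) ^ 2 * W := by positivity
    refine le_of_mul_le_mul_right (le_trans ?_ hray) hp
    have : d + 2 * (1 / R) * W + (1 / R) ^ 2 * ν * W - (d + W / R) * (1 + (1 / R) ^ 2 * W)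
        = W / R ^ 3 * (R * (R - (d - ν)) - W) := by
      field_simp; ring
    have h2 : 0 ≤ W / R ^ 3 * (R * (R - (d - ν)) - W) :=
      mul_nonneg (by positivity) (by linarith)
    linarith
  have hlast : Real.sqrt 2 * s ^ 2 / (2 * n ^ 2 * Real.sqrt (d * n)) ≤ W / R := by
    have hq : 0 < Real.sqrt (d * n) := Real.sqrt_pos.mpr hdn
    have h2 : Real.sqrt 2 ^ 2 = 2 := Real.sq_sqrt (by norm_num)
    have h2p : 0 < Real.sqrt 2 := by positivity
    have : Real.sqrt 2 * s ^ 2 / (2 * n ^ 2 * Real.sqrt (d * n)) = s ^ 2 / n ^ 2 / R := by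
      rw [hRdef]; field_simp; rw [h2]
    rw [this]
    apply div_le_div_of_nonneg_right _ hRpos.le
    rw [hW, div_le_div_iff₀ (by positivity) hnpos]
    nlinarith
  linarith

theorem nikiforov_conjectured_lower_bound
    {V : Type*} [Fintype V] [DecidableEq V] (G : SimpleGraph V) [DecidableRel G.Adj]
    (n d s lam : ℝ)
    (hn : n = Fintype.card V)
    (hd : d = 2 * G.edgeFinset.card / n)
    (hs : s = ∑ u : V, |(G.degree u : ℝ) - d|)
    (hlam : IsLargestEigenvalue (G.adjMatrix ℝ) lam)
    (hspos : 0 < s) :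
    lam ≥ d + Real.sqrt 2 * s ^ 2 / (2 * n ^ 2 * Real.sqrt (d * n)) := by
  have hnpos : 0 < n := by
    rw [hn]
    rcases isEmpty_or_nonempty V with h | h
    · simp [hs] at hspos
    · exact_mod_cast Fintype.card_pos
  have hdeg : ∑ i, (G.degree i : ℝ) = d * n := by
    have := G.sum_degrees_eq_twice_card_edges
    rw [hd, div_mul_cancel₀ _ hnpos.ne']
    exact_mod_cast this
  have hrow : ∀ i, ∑ j, G.adjMatrix ℝ i j = G.degree i := by
    intro i
    simp only [SimpleGraph.adjMatrix_apply, Finset.sum_boole]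
    rw [← G.card_neighborFinset_eq_degree, G.neighborFinset_eq_filter]
  refine core_aux (fun i j => G.adjMatrix ℝ i j) (fun i => (G.degree i : ℝ) - d) n d s lam hn
    hnpos ?_ ?_ ?_ ?_ hs hspos ?_
  · intro i j; simp [SimpleGraph.adjMatrix_apply, G.adj_comm]
  · intro i; rw [hrow]; ring
  · rw [Finset.sum_sub_distrib, hdeg]; simp [hn]; ring
  · rw [← hdeg]
    refine Finset.sum_congr rfl fun i _ => ?_
    rw [← hrow]
    refine Finset.sum_congr rfl fun j _ => ?_
    simp [SimpleGraph.adjMatrix_apply]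
  · exact rayleigh_aux _ (by
      ext i j; simp [SimpleGraph.adjMatrix_apply, G.adj_comm]) lam hlam
end

section
/- If G is a finite simple graph with n vertices, average degree d, and degree deviation s such that n/2 < d ≤ 0.8n and s ≥ 7n(d − n/2)/10, then λ(G) ≥ d + 4s²/(n(3n−2d)(2d+n)) − 24(2d−n)s³/(n²(3n−2d)²(2d+n)²). -/
theorem aux_poly (D s : ℝ) (hD : 0 < D) (hD2 : D ≤ 0.6) (hs : 0.35 * D ≤ s) (hs2 : s ≤ 1/2) :
    (D-3*s)*(D+s)/4 + s^3 - s^4 + s^3*D + s^2*D^2/4 - s*D^2/4 ≤ 0 := by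
  have hs0 : 0 < s := by linarith
  obtain ⟨x, rfl⟩ : ∃ x, s = 0.35 * D + x := ⟨s - 0.35*D, by ring⟩
  have hx : 0 ≤ x := by linarith
  have h1 := mul_nonneg hD.le hx
  nlinarith [mul_nonneg h1 hx, mul_nonneg h1 hD.le, mul_nonneg h1 (sub_nonneg.2 hD2), mul_nonneg h1 (sub_nonneg.2 hs2), mul_nonneg (mul_nonneg hx hx) (sub_nonneg.2 hs2), mul_nonneg (mul_nonneg hx hx) (sub_nonneg.2 hD2), mul_pos hD hD, pow_pos hD 3, mul_nonneg (sq_nonneg (0.35*D+x)) (mul_nonneg (sub_nonneg.2 hs2) (sub_nonneg.2 hs2)), mul_nonneg (mul_pos hD hD).le (mul_nonneg (sub_nonneg.2 hD2) (sub_nonneg.2 hs2)), mul_nonneg h1 (mul_nonneg (sub_nonneg.2 hD2) (sub_nonneg.2 hs2)),mul_nonneg (mul_nonneg hx hx) (mul_nonneg (sub_nonneg.2 hD2) (sub_nonneg.2 hs2))]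

theorem aux_disc (D s b Q W : ℝ) (hD : 0 < D) (hD2 : D ≤ 0.6) (hs : 0.35 * D ≤ s) (hs2 : s ≤ 1/2)
    (hW : W = 1 - D^2/4 + 3/2*D*s) (hQ1 : Q ≤ (1-b)*b) (hQ2 : Q ≤ b*((1+D)/2) - s/2) :
    s^2*(b-b^2) + W*(Q + s/2 - b*s) ≤ W^2/4 := by
  have hs0 : 0 < s := by linarith
  have hp := aux_poly D s hD hD2 hs hs2
  have hW1 : 1 ≤ W := by rw [hW]; nlinarith [mul_le_mul_of_nonneg_left hs hD.le]
  have hQ : Q ≤ (1-s)*((1-b)*b) + s*(b*((1+D)/2) - s/2) := by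
    nlinarith [mul_le_mul_of_nonneg_left hQ1 (by linarith : 0 ≤ 1 - s), mul_le_mul_of_nonneg_left hQ2 hs0.le]
  have hA : 0 < s^2 + W*(1-s) := by
    have : 0 < W*(1-s) := by apply mul_pos <;> linarith
    positivity
  obtain ⟨A, hAd⟩ : ∃ A, A = s^2 + W*(1-s) := ⟨_, rfl⟩
  obtain ⟨B, hBd⟩ : ∃ B, B = s^2 + W*((1-s)+s*((1+D)/2)-s) := ⟨_, rfl⟩
  obtain ⟨C, hCd⟩ : ∃ C, C = W*(s/2-s*s/2) - W^2/4 := ⟨_, rfl⟩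
  have hdisc : B^2 + 4*A*C ≤ 0 := by
    have e1 : B^2 + 4*A*C = s^4 + W*(2*s^2*(1-3/2*s+s*D/2)+2*s^3*(1-s)) + W^2*(s*D+s^2*((3/2-D/2)^2-5)+2*s^3-(W-1)*(1-s)) := by
      rw [hAd, hBd, hCd]; ring
    have e2 : W^2*(2*s^2*(1-3/2*s+s*D/2)+2*s^3*(1-s)) + W^2*(s*D+s^2*((3/2-D/2)^2-5)+2*s^3-(W-1)*(1-s)) + W^2*s^4 = W^2*((D-3*s)*(D+s)/4 + s^3 - s^4 + s^3*D + s^2*D^2/4 - s*D^2/4) := by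
      have : W - 1 = - D^2/4 + 3/2*D*s := by rw [hW]; ring
      rw [this]; ring
    have k : 0 ≤ 2*s^2*(1-3/2*s+s*D/2)+2*s^3*(1-s) := by
      have : 0 ≤ 1-3/2*s+s*D/2 := by nlinarith
      have : 0 ≤ 1 - s := by linarith
      positivity
    have hWW : W ≤ W^2 := by nlinarith
    have h3 := mul_le_mul_of_nonneg_right hWW k
    have h4 : s^4 ≤ W^2*s^4 := le_mul_of_one_le_left (by positivity) (by linarith)
    have h5 := mul_nonneg (sq_nonneg W) (neg_nonneg.2 hp)
    rw [mul_neg] at h5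
    rw [e1]
    linarith
  rw [← hAd] at hA
  have hm : s^2*(b-b^2) + W*(Q + s/2 - b*s) - W^2/4 ≤ -A*b^2 + B*b + C := by
    have := mul_le_mul_of_nonneg_left hQ (by linarith : 0 ≤ W)
    rw [hAd, hBd, hCd]; nlinarith
  have : 0 ≤ 4*A*(-(-A*b^2 + B*b + C)) := by nlinarith [sq_nonneg (2*A*b - B)]
  have := nonneg_of_mul_nonneg_right this (by positivity)
  linarith

theorem aux_norm (a b P Q R s d l : ℝ) (ha : 0 ≤ a) (hb : 0 ≤ b) (hab : a + b = 1)
    (h1 : P + Q = a*d + s/2) (h2 : Q + R = b*d - s/2) (hQ : Q ≤ a*b) (hR : 0 ≤ R) (hQ0 : 0 ≤ Q) (hP : P ≤ a^2)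
    (hd1 : 1/2 < d) (hd2 : d ≤ 0.8) (hs : 7/10*(d-1/2) ≤ s)
    (hl : ∀ x y : ℝ, x^2*P + 2*(x*y*Q) + y^2*R ≤ l*(x^2*a+y^2*b)) :
    d + 4*s^2/((3-2*d)*(2*d+1)) - 24*(2*d-1)*s^3/((3-2*d)^2*(2*d+1)^2) ≤ l := by
  obtain ⟨D, rfl⟩ : ∃ D, d = (1+D)/2 := ⟨2*d-1, by ring⟩
  obtain rfl : a = 1 - b := by linarith
  have hD : 0 < D := by linarith
  have hD2 : D ≤ 0.6 := by linarith
  have hs' : 0.35 * D ≤ s := by linarith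
  have hs0 : 0 < s := by linarith
  have hs2 : s ≤ 1/2 := by
    have u1 : s/2 ≤ (1-b)*(1-(1+D)/2) := by nlinarith
    have u2 : s/2 ≤ b*((1+D)/2) := by
      linarith
    nlinarith [mul_le_mul_of_nonneg_right u1 (by linarith : 0 ≤ (1+D)/2), mul_le_mul_of_nonneg_right u2 (by linarith : 0 ≤ 1-(1+D)/2)]
  obtain ⟨W, hW⟩ : ∃ W, W = 1 - D^2/4 + 3/2*D*s := ⟨_, rfl⟩
  have hW1 : 1 ≤ W := by rw [hW]; nlinarith [mul_le_mul_of_nonneg_left hs' hD.le]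
  have hF := aux_disc D s b Q W hD hD2 hs' hs2 hW hQ (by linarith)
  have hray := hl (W + 2*s*b) (W - 2*s*(1-b))
  have hPe : P = (1-b)*((1+D)/2) + s/2 - Q := by linarith
  have hRe : R = b*((1+D)/2) - s/2 - Q := by linarith
  have hray2 : 2*s^2*W + 4*s^2*((b-(1-b))*s/2 - Q) ≤ (l-(1+D)/2)*(W^2+4*s^2*((1-b)*b)) := by
    rw [hPe, hRe] at hray
    have e : (W + 2*s*b)^2*((1-b)*((1+D)/2) + s/2 - Q) + 2*((W + 2*s*b)*(W - 2*s*(1-b))*Q) + (W - 2*s*(1-b))^2*(b*((1+D)/2) - s/2 - Q) = (1+D)/2*(W^2+4*s^2*((1-b)*b)) + (2*s^2*W + 4*s^2*((b-(1-b))*s/2 - Q)) := by ring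
    have e' : (W + 2*s*b)^2*(1-b) + (W - 2*s*(1-b))^2*b = W^2+4*s^2*((1-b)*b) := by ring
    rw [e, e'] at hray
    linarith
  have hpos : 0 < W^2+4*s^2*((1-b)*b) := by
    have := mul_nonneg ha hb
    positivity
  have hT : s^2/W ≤ l - (1+D)/2 := by
    have hW0 : 0 < W := by linarith
    rw [div_le_iff₀ hW0]
    refine le_of_mul_le_mul_right ?_ hpos
    have v1 := mul_le_mul_of_nonneg_right hray2 hW0.le
    have v2 := mul_le_mul_of_nonneg_left hF (by positivity : 0 ≤ 4*s^2)
    refine le_trans ?_ (v1.trans (le_of_eq (by ring)))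
    have e3 : (2*s^2*W + 4*s^2*((b-(1-b))*s/2 - Q))*W - s^2*(W^2+4*s^2*((1-b)*b)) = 4*s^2*(W^2/4) - 4*s^2*(s^2*(b-b^2) + W*(Q + s/2 - b*s)) := by ring
    linarith
  have hTT : 4*s^2/((3-2*((1+D)/2))*(2*((1+D)/2)+1)) - 24*(2*((1+D)/2)-1)*s^3/((3-2*((1+D)/2))^2*(2*((1+D)/2)+1)^2) ≤ s^2/W := by
    have hK : 0 < 4 - D^2 := by nlinarith
    have e : 4*s^2/((3-2*((1+D)/2))*(2*((1+D)/2)+1)) - 24*(2*((1+D)/2)-1)*s^3/((3-2*((1+D)/2))^2*(2*((1+D)/2)+1)^2) = 4*s^2*(4-D^2-6*D*s)/(4-D^2)^2 := by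
      rw [show (3-2*((1+D)/2))*(2*((1+D)/2)+1) = 4-D^2 by ring, ← mul_pow, show (3-2*((1+D)/2))*(2*((1+D)/2)+1) = 4-D^2 by ring]
      field_simp
      ring
    rw [e, div_le_div_iff₀ (by positivity) (by linarith), hW]
    have e4 : s^2*(4-D^2)^2 - 4*s^2*(4-D^2-6*D*s)*(1 - D^2/4 + 3/2*D*s) = 36*(D*s*s)^2 := by ring
    linarith [sq_nonneg (D*s*s)]
  linarith

theorem aux_psd {V : Type*} [Fintype V] [DecidableEq V] (A : Matrix V V ℝ) (hA : A.IsHermitian)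
    (l : ℝ) (hl : IsLargestEigenvalue A l) (x : V → ℝ) : x ⬝ᵥ A.mulVec x ≤ l * (x ⬝ᵥ x) := by
  have hH : (l • (1 : Matrix V V ℝ) - A).IsHermitian := by
    apply Matrix.IsHermitian.sub _ hA
    ext i j
    simp [Matrix.one_apply, eq_comm]
  have hp : (l • (1 : Matrix V V ℝ) - A).PosSemidef := by
    rw [hH.posSemidef_iff_eigenvalues_nonneg]
    intro i
    have h := hH.mulVec_eigenvectorBasis i
    have hne : (⇑(hH.eigenvectorBasis i) : V → ℝ) ≠ 0 := by
      intro h0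
      apply hH.eigenvectorBasis.orthonormal.ne_zero i
      ext j
      exact congrFun h0 j
    have := hl.2 (l - hH.eigenvalues i) ⟨_, hne, by
      rw [Matrix.sub_mulVec, Matrix.smul_mulVec, Matrix.one_mulVec] at h
      rw [sub_smul, ← h]; abel⟩
    simp only [Pi.zero_apply]
    linarith
  have := hp.dotProduct_mulVec_nonneg x
  rw [Matrix.sub_mulVec, Matrix.smul_mulVec, Matrix.one_mulVec] at this
  simp at this
  linarith

/-- If `G` is a finite simple graph with `n` vertices, average degree `d`,
and degree deviation `s` such that `n/2 < d ≤ 0.8n` and `s ≥ 7n(d − n/2)/10`, then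
`λ(G) ≥ d + 4s²/(n(3n−2d)(2d+n)) − 24(2d−n)s³/(n²(3n−2d)²(2d+n)²)`. -/
theorem spectral_radius_lower_bound_middle_range
    {V : Type*} [Fintype V] [DecidableEq V] (G : SimpleGraph V) [DecidableRel G.Adj]
    (n d s lam : ℝ)
    (hn : n = Fintype.card V)
    (hd : d = 2 * G.edgeFinset.card / n)
    (hs : s = ∑ u : V, |(G.degree u : ℝ) - d|)
    (hlam : IsLargestEigenvalue (G.adjMatrix ℝ) lam)
    (hd1 : n / 2 < d) (hd2 : d ≤ 0.8 * n)
    (hsl : s ≥ 7 * n * (d - n / 2) / 10) :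
    lam ≥ d + 4 * s ^ 2 / (n * (3 * n - 2 * d) * (2 * d + n))
            - 24 * (2 * d - n) * s ^ 3 / (n ^ 2 * (3 * n - 2 * d) ^ 2 * (2 * d + n) ^ 2) := by
  classical
  have hn0 : 0 < n := by
    have : 0 ≤ n := by rw [hn]; positivity
    linarith
  obtain ⟨S, hS⟩ : ∃ S : Finset V, S = Finset.univ.filter (fun u => d ≤ (G.degree u : ℝ)) := ⟨_, rfl⟩
  set M := G.adjMatrix ℝ with hM
  set a : ℝ := (S.card : ℝ) with ha
  set b : ℝ := (Sᶜ.card : ℝ) with hb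
  set P : ℝ := ∑ u ∈ S, ∑ v ∈ S, M u v with hP
  set Q : ℝ := ∑ u ∈ S, ∑ v ∈ Sᶜ, M u v with hQ
  set R : ℝ := ∑ u ∈ Sᶜ, ∑ v ∈ Sᶜ, M u v with hR
  have hM1 : ∀ u v, M u v ≤ 1 := by
    intro u v; rw [hM, SimpleGraph.adjMatrix_apply]; split_ifs <;> norm_num
  have hM0 : ∀ u v, 0 ≤ M u v := by
    intro u v; rw [hM, SimpleGraph.adjMatrix_apply]; split_ifs <;> norm_num
  have hMs : ∀ u v, M u v = M v u := by
    intro u v; simp [hM, SimpleGraph.adjMatrix_apply, G.adj_comm]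
  have hQ' : ∑ u ∈ Sᶜ, ∑ v ∈ S, M u v = Q := by
    refine Finset.sum_comm.trans ?_
    exact Finset.sum_congr rfl fun u _ => Finset.sum_congr rfl fun v _ => hMs _ _
  have hdeg : ∀ u, (G.degree u : ℝ) = ∑ v ∈ S, M u v + ∑ v ∈ Sᶜ, M u v := by
    intro u
    rw [Finset.sum_add_sum_compl]
    simp [hM, SimpleGraph.adjMatrix_apply, SimpleGraph.degree, SimpleGraph.neighborFinset_eq_filter]
  have hab : a + b = n := by
    rw [hn, ha, hb]; exact_mod_cast Finset.card_add_card_compl S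
  have hsum : ∑ u, (G.degree u : ℝ) = n * d := by
    have := G.sum_degrees_eq_twice_card_edges
    rw [hd, mul_div_cancel₀ _ hn0.ne']
    exact_mod_cast this
  have hsS : s = ∑ u ∈ S, ((G.degree u : ℝ) - d) + ∑ u ∈ Sᶜ, (d - (G.degree u : ℝ)) := by
    rw [hs, ← Finset.sum_add_sum_compl S]
    congr 1
    · refine Finset.sum_congr rfl fun u hu => abs_of_nonneg ?_
      simp [hS] at hu; linarith
    · refine Finset.sum_congr rfl fun u hu => ?_
      simp [hS] at hu
      rw [abs_of_nonpos (by linarith)]; ring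
  rw [Finset.sum_sub_distrib, Finset.sum_sub_distrib, Finset.sum_const, Finset.sum_const, nsmul_eq_mul, nsmul_eq_mul, ← ha, ← hb] at hsS
  rw [← Finset.sum_add_sum_compl S] at hsum
  have hPQ : ∑ u ∈ S, (G.degree u : ℝ) = P + Q := by
    rw [Finset.sum_congr rfl fun u _ => hdeg u, Finset.sum_add_distrib]
  have hQR : ∑ u ∈ Sᶜ, (G.degree u : ℝ) = Q + R := by
    rw [Finset.sum_congr rfl fun u _ => hdeg u, Finset.sum_add_distrib, hQ']
  rw [hPQ, hQR] at hsum hsS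
  have h1 : P + Q = a*d + s/2 := by rw [← hab] at hsum; linarith
  have h2 : Q + R = b*d - s/2 := by rw [← hab] at hsum; linarith
  have hbd : ∀ X Y : Finset V, ∑ u ∈ X, ∑ v ∈ Y, M u v ≤ X.card * Y.card := by
    intro X Y
    calc _ ≤ ∑ u ∈ X, ∑ v ∈ Y, (1:ℝ) := Finset.sum_le_sum fun u _ => Finset.sum_le_sum fun v _ => hM1 u v
      _ = _ := by simp
  have hR0 : 0 ≤ R := Finset.sum_nonneg fun u _ => Finset.sum_nonneg fun v _ => hM0 u v
  have hQ0 : 0 ≤ Q := Finset.sum_nonneg fun u _ => Finset.sum_nonneg fun v _ => hM0 u v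
  have hl : ∀ x y : ℝ, x^2*P + 2*(x*y*Q) + y^2*R ≤ lam*(x^2*a+y^2*b) := by
    intro x y
    have := aux_psd M (by ext i j; simp [hMs i j]) lam hlam (fun u => if u ∈ S then x else y)
    have in1 : ∀ (f : V → ℝ) , ∑ u ∈ S, (if u ∈ S then x else y) * f u = x * ∑ u ∈ S, f u := by
      intro f; rw [Finset.mul_sum]; exact Finset.sum_congr rfl fun u hu => by rw [if_pos hu]
    have in2 : ∀ (f : V → ℝ) , ∑ u ∈ Sᶜ, (if u ∈ S then x else y) * f u = y * ∑ u ∈ Sᶜ, f u := by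
      intro f; rw [Finset.mul_sum]; exact Finset.sum_congr rfl fun u hu => by rw [if_neg (by simpa using hu)]
    have in3 : ∀ (f : V → ℝ) , ∑ u, (if u ∈ S then x else y) * f u = x * ∑ u ∈ S, f u + y * ∑ u ∈ Sᶜ, f u := by
      intro f; rw [← Finset.sum_add_sum_compl S, in1, in2]
    have e2 : (fun u => if u ∈ S then x else y) ⬝ᵥ (fun u => if u ∈ S then x else y) = x^2*a+y^2*b := by
      rw [dotProduct, in3, Finset.sum_congr rfl (fun u hu => if_pos hu),
        Finset.sum_congr rfl (fun u (hu : u ∈ Sᶜ) => if_neg (by simpa using hu)), Finset.sum_const, Finset.sum_const, nsmul_eq_mul, nsmul_eq_mul]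
      ring
    have e1 : (fun u => if u ∈ S then x else y) ⬝ᵥ M.mulVec (fun u => if u ∈ S then x else y) = x^2*P + 2*(x*y*Q) + y^2*R := by
      have : ∀ u, M.mulVec (fun u => if u ∈ S then x else y) u = x * ∑ v ∈ S, M u v + y * ∑ v ∈ Sᶜ, M u v := by
        intro u
        rw [Matrix.mulVec, dotProduct, ← in3]
        exact Finset.sum_congr rfl fun v _ => mul_comm _ _
      rw [dotProduct, in3]
      simp only [this, Finset.sum_add_distrib, ← Finset.mul_sum]
      rw [hQ']
      ring
    rw [e1, e2] at this
    exact this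
  have bP : P ≤ a * a := hbd _ _
  have bQ : Q ≤ a * b := hbd _ _
  have ha0 : 0 ≤ a := Nat.cast_nonneg _
  have hb0 : 0 ≤ b := Nat.cast_nonneg _
  clear hQ' hPQ hQR
  clear_value P Q R a b
  clear hP hQ hR
  have key := aux_norm (a/n) (b/n) (P/n^2) (Q/n^2) (R/n^2) (s/n^2) (d/n) (lam/n)
    (by positivity) (by positivity) (by rw [← add_div, hab, div_self hn0.ne'])
    (by rw [← add_div, h1]; field_simp) (by rw [← add_div, h2]; field_simp)
    (by rw [div_mul_div_comm, ← sq]; gcongr) (by positivity) (by positivity)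
    (by rw [div_pow]; gcongr; rw [sq]; exact bP)
    (by rw [lt_div_iff₀ hn0]; linarith) (by rw [div_le_iff₀ hn0]; linarith)
    (by
      rw [le_div_iff₀ (by positivity)]
      have : 7/10*(d/n-1/2)*n^2 = 7 * n * (d - n / 2) / 10 := by field_simp
      rw [this]; exact hsl)
    (by
      intro x y
      have := div_le_div_of_nonneg_right (hl x y) (sq_nonneg n)
      have e1 : x^2*(P/n^2) + 2*(x*y*(Q/n^2)) + y^2*(R/n^2) = (x^2*P + 2*(x*y*Q) + y^2*R)/n^2 := by ring
      have e2 : lam/n*(x^2*(a/n)+y^2*(b/n)) = lam*(x^2*a+y^2*b)/n^2 := by ring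
      rw [e1, e2]; exact this)
  have k1 : 0 < 3*n - 2*d := by linarith
  have k2 : 0 < 2*d + n := by linarith
  have k3 : 3 - 2*(d/n) = (3*n-2*d)/n := by field_simp
  have k4 : 2*(d/n) + 1 = (2*d+n)/n := by field_simp
  have k5 : 2*(d/n) - 1 = (2*d-n)/n := by field_simp
  rw [k3, k4, k5, le_div_iff₀ hn0] at key
  refine le_trans (le_of_eq ?_) key
  field_simp
end

section
/- Let G be a finite simple graph with n ≥ 1 vertices, m edges, and average degree d = 2m/n. Let V₊ = {u ∈ V(G) : d_G(u) > d}, V₋ = {u ∈ V(G) : d_G(u) ≤ d}, n₊ = |V₊|, n₋ = |V₋|, and let m₊ and m₋ be the numbers of edges of the induced subgraphs G[V₊] and G[V₋], respectively. Then the degree deviation satisfies s(G) = 2(m₊ − m₋) − d(n₊ − n₋). -/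
theorem sum_eps_aux {V : Type*} [Fintype V] [DecidableEq V] (G : SimpleGraph V) [DecidableRel G.Adj]
    (f : V → ℝ) :
    ∑ u : V, f u * (G.degree u : ℝ) = ∑ e ∈ G.edgeFinset, ∑ u : V with u ∈ e, f u := by
  have h : ∀ u : V, f u * (G.degree u : ℝ) = ∑ e ∈ G.incidenceFinset u, f u := by
    intro u
    rw [Finset.sum_const, SimpleGraph.card_incidenceFinset_eq_degree, nsmul_eq_mul, mul_comm]
  rw [Finset.sum_congr rfl (fun u _ => h u)]
  apply Finset.sum_comm'
  intro u e
  simp [SimpleGraph.incidenceSet, and_comm]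

/-- With `V₊` the set of vertices of degree `> d`, `V₋` those of degree `≤ d`,
and `m₊`, `m₋` the numbers of edges of the induced subgraphs `G[V₊]`, `G[V₋]`
(i.e. edges with both endpoints in the respective set), the degree deviation satisfies
`s(G) = 2(m₊ − m₋) − d(n₊ − n₋)`. -/
theorem degree_deviation_eq_of_partition
    {V : Type*} [Fintype V] [DecidableEq V] (G : SimpleGraph V) [DecidableRel G.Adj]
    (n : ℕ) (hn : n = Fintype.card V) (hn1 : 1 ≤ n)
    (d s : ℝ)
    (hd : d = 2 * G.edgeFinset.card / n)
    (hs : s = ∑ u : V, |(G.degree u : ℝ) - d|)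
    (Vp Vm : Finset V)
    (hVp : Vp = Finset.univ.filter (fun u => d < (G.degree u : ℝ)))
    (hVm : Vm = Finset.univ.filter (fun u => (G.degree u : ℝ) ≤ d))
    (mp mm : ℕ)
    (hmp : mp = (G.edgeFinset.filter (fun e => e ∈ Vp.sym2)).card)
    (hmm : mm = (G.edgeFinset.filter (fun e => e ∈ Vm.sym2)).card) :
    s = 2 * ((mp : ℝ) - (mm : ℝ)) - d * ((Vp.card : ℝ) - (Vm.card : ℝ)) := by
  set f : V → ℝ := fun u => if d < (G.degree u : ℝ) then 1 else -1 with hf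
  have h1 : s = ∑ u : V, f u * (G.degree u : ℝ) - d * ∑ u : V, f u := by
    rw [hs, Finset.mul_sum, ← Finset.sum_sub_distrib]
    refine Finset.sum_congr rfl fun u _ => ?_
    simp only [hf]
    split_ifs with h
    · rw [abs_of_pos (by linarith)]; ring
    · rw [abs_of_nonpos (by linarith)]; ring
  have h2 : ∑ u : V, f u = (Vp.card : ℝ) - (Vm.card : ℝ) := by
    rw [hVp, hVm, Finset.card_filter, Finset.card_filter]
    push_cast
    rw [← Finset.sum_sub_distrib]
    refine Finset.sum_congr rfl fun u _ => ?_
    simp only [hf]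
    by_cases h : d < (G.degree u : ℝ)
    · simp [h, not_le.mpr h]
    · simp [h, not_lt.mp h]
  have h3 : ∑ u : V, f u * (G.degree u : ℝ) = 2 * ((mp : ℝ) - (mm : ℝ)) := by
    rw [sum_eps_aux, hmp, hmm, Finset.card_filter, Finset.card_filter]
    push_cast
    rw [← Finset.sum_sub_distrib, Finset.mul_sum]
    refine Finset.sum_congr rfl fun e he => ?_
    induction e using Sym2.ind with
    | _ a b =>
      have hab : a ≠ b := (SimpleGraph.mem_edgeFinset.mp he : G.Adj a b).ne
      have h4 : (Finset.univ.filter (fun u => u ∈ s(a, b))) = {a, b} := by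
        ext u; simp
      rw [h4, Finset.sum_pair hab]
      simp only [hf, Finset.mk_mem_sym2_iff, hVp, hVm, Finset.mem_filter, Finset.mem_univ, true_and,
        ← not_lt]
      by_cases ha : d < (G.degree a : ℝ) <;> by_cases hb : d < (G.degree b : ℝ) <;>
        simp [ha, hb] <;> norm_num
  rw [h1, h2, h3]
end

section
/- If G is a finite simple graph with n ≥ 1 vertices, m edges, average degree d = 2m/n, and minimum degree at least 1, then s(G) ≤ d·√( 2m·(Σ_{u∈V(G)} 1/d_G(u)) − n² ). -/
/-- If `G` is a finite simple graph with `n ≥ 1` vertices, `m` edges,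
average degree `d = 2m/n`, and minimum degree at least `1`, then
`s(G) ≤ d·√(2m·(∑_u 1/deg u) − n²)`. -/
theorem degree_deviation_le_sqrt_sum_reciprocal_degrees
    {V : Type*} [Fintype V] [DecidableEq V] (G : SimpleGraph V) [DecidableRel G.Adj]
    (n : ℕ) (hn : n = Fintype.card V) (hn1 : 1 ≤ n)
    (m d s : ℝ)
    (hm : m = G.edgeFinset.card)
    (hd : d = 2 * m / n)
    (hs : s = ∑ u : V, |(G.degree u : ℝ) - d|)
    (hdeg : ∀ u : V, 1 ≤ G.degree u) :
    s ≤ d * Real.sqrt (2 * m * (∑ u : V, 1 / (G.degree u : ℝ)) - (n : ℝ) ^ 2) := by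
  have hsum : ∑ u : V, (G.degree u : ℝ) = 2 * m := by
    rw [hm]; exact_mod_cast G.sum_degrees_eq_twice_card_edges
  have hn0 : (n : ℝ) ≠ 0 := by positivity
  have hdn : d * n = 2 * m := by rw [hd]; field_simp
  have hm0 : 0 ≤ m := by rw [hm]; positivity
  have hd0 : 0 ≤ d := by rw [hd]; positivity
  have hpos : ∀ u : V, (0 : ℝ) < G.degree u := fun u => by exact_mod_cast hdeg u
  have key := Finset.sum_sq_le_sum_mul_sum_of_sq_eq_mul (Finset.univ : Finset V)
    (r := fun u => |(G.degree u : ℝ) - d|) (f := fun u => (G.degree u : ℝ))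
    (g := fun u => (G.degree u : ℝ) - 2 * d + d ^ 2 * (1 / (G.degree u : ℝ)))
    (fun u _ => (hpos u).le)
    (fun u _ => by
      have h := hpos u
      have e : (G.degree u : ℝ) - 2 * d + d ^ 2 * (1 / (G.degree u : ℝ))
          = ((G.degree u : ℝ) - d) ^ 2 / (G.degree u : ℝ) := by field_simp; ring
      simp only [e]
      positivity)
    (fun u _ => by
      have h := hpos u
      simp only [sq_abs]
      field_simp
      ring)
  rw [← hs, Finset.sum_add_distrib, Finset.sum_sub_distrib, hsum,
    Finset.sum_const, ← Finset.mul_sum, Finset.card_univ, ← hn, nsmul_eq_mul] at key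
  have h2 : s ^ 2 ≤ d ^ 2 * (2 * m * (∑ u : V, 1 / (G.degree u : ℝ)) - (n : ℝ) ^ 2) := by
    refine key.trans (le_of_eq ?_)
    rw [← hdn]; ring
  have h3 := Real.abs_le_sqrt h2
  rw [Real.sqrt_mul (sq_nonneg d), Real.sqrt_sq hd0] at h3
  exact (le_abs_self s).trans h3
end

section
/- If G is a finite simple graph with n ≥ 1 vertices, m edges, average degree d = 2m/n, and every vertex degree lies in the interval [δ, Δ] with δ > 0, then s(G) ≤ dn·√( (Δ−d)(d−δ)/(δΔ) ). -/
/-- If `G` is a finite simple graph with `n ≥ 1` vertices, `m` edges,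
average degree `d = 2m/n`, and every vertex degree lies in `[δ, Δ]` with `δ > 0`, then
`s(G) ≤ dn·√((Δ−d)(d−δ)/(δΔ))`. -/
theorem degree_deviation_upper_bound_ali
    {V : Type*} [Fintype V] [DecidableEq V] (G : SimpleGraph V) [DecidableRel G.Adj]
    (n : ℕ) (hn : n = Fintype.card V) (hn1 : 1 ≤ n)
    (d δ Δ s : ℝ)
    (hd : d = 2 * G.edgeFinset.card / n)
    (hs : s = ∑ u : V, |(G.degree u : ℝ) - d|)
    (hδpos : 0 < δ)
    (hdeg : ∀ u : V, δ ≤ (G.degree u : ℝ) ∧ (G.degree u : ℝ) ≤ Δ) :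
    s ≤ d * n * Real.sqrt ((Δ - d) * (d - δ) / (δ * Δ)) := by
  have hnpos : (0:ℝ) < n := by exact_mod_cast hn1
  have hsum : ∑ u : V, (G.degree u : ℝ) = d * n := by
    have h := G.sum_degrees_eq_twice_card_edges
    have h' : ∑ u : V, (G.degree u : ℝ) = 2 * G.edgeFinset.card := by exact_mod_cast h
    rw [h', hd]; field_simp
  have hone : ∑ _u : V, (1:ℝ) = n := by simp [hn]
  have hxpos : ∀ u : V, (0:ℝ) < G.degree u := fun u => hδpos.trans_le (hdeg u).1
  have hΔpos : 0 < Δ := by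
    have : 0 < Fintype.card V := by omega
    obtain ⟨u⟩ := Fintype.card_pos_iff.mp this
    exact (hxpos u).trans_le (hdeg u).2
  have hδd : δ ≤ d := by
    have h : ∑ _u : V, δ ≤ ∑ u : V, (G.degree u : ℝ) :=
      Finset.sum_le_sum fun u _ => (hdeg u).1
    rw [hsum] at h
    simp only [Finset.sum_const, Finset.card_univ, ← hn, nsmul_eq_mul] at h
    nlinarith
  have hdΔ : d ≤ Δ := by
    have h : ∑ u : V, (G.degree u : ℝ) ≤ ∑ _u : V, Δ :=
      Finset.sum_le_sum fun u _ => (hdeg u).2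
    rw [hsum] at h
    simp only [Finset.sum_const, Finset.card_univ, ← hn, nsmul_eq_mul] at h
    nlinarith
  have hdpos : 0 < d := hδpos.trans_le hδd
  have hK : 0 ≤ (Δ - d) * (d - δ) / (δ * Δ) :=
    div_nonneg (mul_nonneg (by linarith) (by linarith)) (by positivity)
  have hcs : s ^ 2 ≤ (∑ u : V, (G.degree u : ℝ)) *
      ∑ u : V, ((G.degree u : ℝ) - d) ^ 2 / G.degree u := by
    rw [hs]
    apply Finset.sum_sq_le_sum_mul_sum_of_sq_eq_mul
    · intro u _; exact (hxpos u).le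
    · intro u _; exact div_nonneg (sq_nonneg _) (hxpos u).le
    · intro u _
      have := (hxpos u).ne'
      rw [sq_abs]; field_simp
  have hpt : ∑ u : V, ((G.degree u : ℝ) - d) ^ 2 / G.degree u ≤
      ∑ u : V, ((1 - d ^ 2 / (δ * Δ)) * (G.degree u : ℝ) +
        (d ^ 2 * (δ + Δ) / (δ * Δ) - 2 * d) * 1) := by
    apply Finset.sum_le_sum
    intro u _
    have hx := hxpos u
    obtain ⟨h1, h2⟩ := hdeg u
    generalize (G.degree u : ℝ) = x at *
    have key : (1 - d ^ 2 / (δ * Δ)) * x + (d ^ 2 * (δ + Δ) / (δ * Δ) - 2 * d) * 1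
        - (x - d) ^ 2 / x = d ^ 2 * ((x - δ) * (Δ - x)) / (δ * Δ * x) := by
      field_simp; ring
    have : 0 ≤ d ^ 2 * ((x - δ) * (Δ - x)) / (δ * Δ * x) :=
      div_nonneg (mul_nonneg (sq_nonneg _) (mul_nonneg (by linarith) (by linarith)))
        (by positivity)
    linarith
  rw [Finset.sum_add_distrib, ← Finset.mul_sum, ← Finset.mul_sum, hsum, hone] at hpt
  have hfin : s ^ 2 ≤ (d * n * Real.sqrt ((Δ - d) * (d - δ) / (δ * Δ))) ^ 2 := by
    rw [mul_pow, Real.sq_sqrt hK]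
    rw [hsum] at hcs
    refine hcs.trans ((mul_le_mul_of_nonneg_left hpt (by positivity)).trans (le_of_eq ?_))
    field_simp; ring
  exact le_of_abs_le (abs_le_of_sq_le_sq hfin (by positivity))
end

section
/- Let G be a finite simple graph with n ≥ 1 vertices, m edges, average degree d = 2m/n, minimum degree exactly δ, and maximum degree exactly Δ, where 0 < δ < Δ. If s(G) = dn·√( (Δ−d)(d−δ)/(δΔ) ), then every vertex of G has degree δ or Δ, and d = 2δΔ/(Δ+δ). -/
/-- Let `G` be a finite simple graph with `n ≥ 1` vertices, `m` edges,
average degree `d = 2m/n`, minimum degree exactly `δ` and maximum degree exactly `Δ`,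
where `0 < δ < Δ`. If `s(G) = dn·√((Δ−d)(d−δ)/(δΔ))`, then every vertex of `G` has degree
`δ` or `Δ`, and `d = 2δΔ/(Δ+δ)`. -/
theorem degree_deviation_ali_equality_case
    {V : Type*} [Fintype V] [DecidableEq V] (G : SimpleGraph V) [DecidableRel G.Adj]
    (n : ℕ) (hn : n = Fintype.card V) (hn1 : 1 ≤ n)
    (δ Δ : ℕ) (hδpos : 0 < δ) (hδΔ : δ < Δ)
    (d s : ℝ)
    (hd : d = 2 * G.edgeFinset.card / n)
    (hs : s = ∑ u : V, |(G.degree u : ℝ) - d|)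
    (hδmin : (∀ u : V, δ ≤ G.degree u) ∧ ∃ u : V, G.degree u = δ)
    (hΔmax : (∀ u : V, G.degree u ≤ Δ) ∧ ∃ u : V, G.degree u = Δ)
    (heq : s = d * n * Real.sqrt (((Δ : ℝ) - d) * (d - (δ : ℝ)) / ((δ : ℝ) * (Δ : ℝ)))) :
    (∀ u : V, G.degree u = δ ∨ G.degree u = Δ) ∧
    d = 2 * (δ : ℝ) * (Δ : ℝ) / ((Δ : ℝ) + (δ : ℝ)) := by
  have hnpos : (0 : ℝ) < n := by exact_mod_cast hn1
  have ha : (0 : ℝ) < δ := by exact_mod_cast hδpos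
  have hab : (δ : ℝ) < Δ := by exact_mod_cast hδΔ
  have hb : (0 : ℝ) < Δ := ha.trans hab
  have hsum : ∑ u : V, (G.degree u : ℝ) = d * n := by
    have h := G.sum_degrees_eq_twice_card_edges
    have h2 : ∑ u : V, (G.degree u : ℝ) = 2 * (G.edgeFinset.card : ℝ) := by exact_mod_cast h
    rw [h2, hd]; field_simp
  have hcard : ∑ u : V, (1 : ℝ) = n := by simp [hn]
  have hspos : 0 < s := by
    obtain ⟨u, hu⟩ := hδmin.2
    obtain ⟨v, hv⟩ := hΔmax.2
    have h0 : 0 ≤ s := by rw [hs]; exact Finset.sum_nonneg fun _ _ => abs_nonneg _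
    rcases h0.lt_or_eq with h | h
    · exact h
    · exfalso
      rw [hs] at h
      have h1 := (Finset.sum_eq_zero_iff_of_nonneg (fun _ _ => abs_nonneg _)).1 h.symm
      have h2 := abs_eq_zero.1 (h1 u (Finset.mem_univ u))
      have h3 := abs_eq_zero.1 (h1 v (Finset.mem_univ v))
      rw [hu] at h2
      rw [hv] at h3
      linarith
  set r := Real.sqrt (((Δ : ℝ) - d) * (d - (δ : ℝ)) / ((δ : ℝ) * (Δ : ℝ))) with hr
  have hd0 : 0 ≤ d := by rw [hd]; positivity
  have hrpos : 0 < r := by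
    rcases (Real.sqrt_nonneg _ : 0 ≤ r).lt_or_eq with h | h
    · exact h
    · rw [hr, ← h] at heq; linarith
  have hq : 0 < ((Δ : ℝ) - d) * (d - (δ : ℝ)) / ((δ : ℝ) * (Δ : ℝ)) := Real.sqrt_pos.1 hrpos
  have hr2 : r ^ 2 * (δ * Δ) = (Δ - d) * (d - δ) := by
    rw [hr, Real.sq_sqrt hq.le]; field_simp
  have hP : 0 < ((Δ : ℝ) - d) * (d - δ) := by rw [← hr2]; positivity
  have hda : (δ : ℝ) < d := by
    by_contra h
    push Not at h
    nlinarith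
  have hdb : d < Δ := by
    by_contra h
    push Not at h
    nlinarith
  have key : ∀ u : V, 0 ≤ (Δ - (G.degree u : ℝ)) * (d - δ) + ((G.degree u : ℝ) - δ) * (Δ - d)
      - |(G.degree u : ℝ) - d| * (Δ - δ) := by
    intro u
    have h1 : (δ : ℝ) ≤ G.degree u := by exact_mod_cast hδmin.1 u
    have h2 : (G.degree u : ℝ) ≤ Δ := by exact_mod_cast hΔmax.1 u
    rcases abs_cases ((G.degree u : ℝ) - d) with ⟨h, _⟩ | ⟨h, _⟩ <;> rw [h] <;> nlinarith
  have hS : ∑ u : V, ((Δ - (G.degree u : ℝ)) * (d - δ) + ((G.degree u : ℝ) - δ) * (Δ - d)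
      - |(G.degree u : ℝ) - d| * (Δ - δ)) = 2 * n * ((Δ - d) * (d - δ)) - s * (Δ - δ) := by
    rw [Finset.sum_sub_distrib, ← Finset.sum_mul, ← hs]
    have : ∀ u : V, (Δ - (G.degree u : ℝ)) * (d - δ) + ((G.degree u : ℝ) - δ) * (Δ - d)
      = (G.degree u : ℝ) * (Δ + δ - 2 * d) + 1 * (Δ * (d - δ) - δ * (Δ - d)) := by
      intro u; ring
    rw [Finset.sum_congr rfl fun u _ => this u, Finset.sum_add_distrib, ← Finset.sum_mul,
      ← Finset.sum_mul, hsum, hcard]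
    ring
  have hS2 : 2 * n * ((Δ - d) * (d - δ)) - s * (Δ - δ)
      = (n * r) * (2 * r * (δ * Δ) - d * (Δ - δ)) := by
    rw [← hr2, heq]; ring
  have hS0 := Finset.sum_nonneg fun u (_ : u ∈ Finset.univ) => key u
  rw [hS, hS2] at hS0
  have hle : 0 ≤ 2 * r * (δ * Δ) - d * (Δ - δ) :=
    nonneg_of_mul_nonneg_right hS0 (by positivity)
  have hid : (2 * r * (δ * Δ)) ^ 2 - (d * (Δ - δ)) ^ 2 = - (d * (Δ + δ) - 2 * δ * Δ) ^ 2 := by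
    have : (2 * r * (δ * Δ)) ^ 2 = 4 * (δ * Δ) * (r ^ 2 * (δ * Δ)) := by ring
    rw [this, hr2]; ring
  have hx : 0 ≤ d * (Δ - δ) := mul_nonneg hd0 (by linarith)
  have hge : 0 ≤ (2 * r * (δ * Δ)) ^ 2 - (d * (Δ - δ)) ^ 2 := by nlinarith
  have hz : d * (Δ + δ) - 2 * δ * Δ = 0 := by
    have := sq_nonneg (d * (Δ + δ) - 2 * δ * Δ : ℝ)
    exact pow_eq_zero_iff (two_ne_zero) |>.1 (by linarith)
  refine ⟨?_, by rw [eq_div_iff (by positivity)]; linarith⟩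
  have he : 2 * r * (δ * Δ) - d * (Δ - δ) = 0 := by
    rw [hz] at hid
    have h1 : (2 * r * (δ * Δ)) ^ 2 = (d * (Δ - δ)) ^ 2 := by linarith
    have := (sq_eq_sq₀ (by positivity) hx).1 h1
    linarith
  rw [hS2, he, mul_zero] at hS
  have hall := (Finset.sum_eq_zero_iff_of_nonneg (fun u _ => key u)).1 hS
  intro u
  have hu := hall u (Finset.mem_univ u)
  rcases abs_cases ((G.degree u : ℝ) - d) with ⟨h, _⟩ | ⟨h, _⟩ <;> rw [h] at hu
  · right
    have h3 : (Δ - (G.degree u : ℝ)) * (d - δ) = 0 := by linarith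
    rcases mul_eq_zero.1 h3 with h4 | h4
    · have : (G.degree u : ℝ) = Δ := by linarith
      exact_mod_cast this
    · linarith
  · left
    have h3 : ((G.degree u : ℝ) - δ) * (Δ - d) = 0 := by linarith
    rcases mul_eq_zero.1 h3 with h4 | h4
    · have : (G.degree u : ℝ) = δ := by linarith
      exact_mod_cast this
    · linarith
end

section
/- Let n, d, δ, Δ be real numbers with 0 ≤ δ < d < Δ < n. Let real numbers n₊, n₋ ≥ 1 and w₊, w₋, w_± ∈ [0,1] satisfy: n₊ + n₋ = n; (n₊(n₊−1)/2)w₊ + n₊n₋w_± + (n₋(n₋−1)/2)w₋ = dn/2; d ≤ (n₊−1)w₊ + n₋w_± ≤ Δ; and δ ≤ (n₋−1)w₋ + n₊w_± ≤ d. Then n₊((n₊−1)w₊ − d) + n₋(d − (n₋−1)w₋) ≤ 2n(Δ−d)(d−δ)/(Δ−δ). -/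
/-- The continuous relaxation `(P)`: any feasible solution
`(n₊, n₋, w₊, w₋, w_±)` has objective value at most `2n(Δ−d)(d−δ)/(Δ−δ)`. -/
theorem relaxation_P_objective_upper_bound
    (n d δ Δ np nm wp wm wpm : ℝ)
    (h0 : 0 ≤ δ) (h1 : δ < d) (h2 : d < Δ) (h3 : Δ < n)
    (hnp : 1 ≤ np) (hnm : 1 ≤ nm)
    (hwp0 : 0 ≤ wp) (hwp1 : wp ≤ 1)
    (hwm0 : 0 ≤ wm) (hwm1 : wm ≤ 1)
    (hwpm0 : 0 ≤ wpm) (hwpm1 : wpm ≤ 1)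
    (he1 : np + nm = n)
    (he2 : np * (np - 1) / 2 * wp + np * nm * wpm + nm * (nm - 1) / 2 * wm = d * n / 2)
    (hdp1 : d ≤ (np - 1) * wp + nm * wpm) (hdp2 : (np - 1) * wp + nm * wpm ≤ Δ)
    (hdm1 : δ ≤ (nm - 1) * wm + np * wpm) (hdm2 : (nm - 1) * wm + np * wpm ≤ d) :
    np * ((np - 1) * wp - d) + nm * (d - (nm - 1) * wm)
      ≤ 2 * n * (Δ - d) * (d - δ) / (Δ - δ) := by
  subst he1
  have hA : np * ((np - 1) * wp - d) + nm * (d - (nm - 1) * wm) ≤ 2 * (np * (Δ - d)) := by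
    have := mul_le_mul_of_nonneg_left hdp2 (by linarith : (0:ℝ) ≤ np)
    linarith
  have hB : np * ((np - 1) * wp - d) + nm * (d - (nm - 1) * wm) ≤ 2 * (nm * (d - δ)) := by
    have := mul_le_mul_of_nonneg_left hdm1 (by linarith : (0:ℝ) ≤ nm)
    linarith
  rw [le_div_iff₀ (by linarith)]
  have h5 := mul_le_mul_of_nonneg_right hA (by linarith : 0 ≤ d - δ)
  have h6 := mul_le_mul_of_nonneg_right hB (by linarith : 0 ≤ Δ - d)
  linarith
end

section
/- Let n, d, Δ be real numbers with 0 < d < Δ < n, d ≤ n−3, and 2Δ ≤ dn < Δ(Δ+1). Let real numbers n₊, n₋ ≥ 1 and w₊, w₋, w_± ∈ [0,1] satisfy: n₊ + n₋ = n; (n₊(n₊−1)/2)w₊ + n₊n₋w_± + (n₋(n₋−1)/2)w₋ = dn/2; d ≤ (n₊−1)w₊ + n₋w_± ≤ Δ; and 0 ≤ (n₋−1)w₋ + n₊w_± ≤ d. Then n₊((n₊−1)w₊ − d) + n₋(d − (n₋−1)w₋) ≤ max{ (2Δ+1 − √((2Δ+1)² − 4dn))(Δ−d), d(2n−1 − √(4dn+1))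 }. -/
/-- The continuous relaxation `(P)` with `δ = 0`: under the extra
assumptions `d ≤ n−3` and `2Δ ≤ dn < Δ(Δ+1)`, any feasible solution has objective value
at most `max{(2Δ+1 − √((2Δ+1)² − 4dn))(Δ−d), d(2n−1 − √(4dn+1))}`. -/
theorem relaxation_P_objective_upper_bound_delta_zero
    (n d Δ np nm wp wm wpm : ℝ)
    (h0 : 0 < d) (h1 : d < Δ) (h2 : Δ < n)
    (h3 : d ≤ n - 3) (h4 : 2 * Δ ≤ d * n) (h5 : d * n < Δ * (Δ + 1))
    (hnp : 1 ≤ np) (hnm : 1 ≤ nm)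
    (hwp0 : 0 ≤ wp) (hwp1 : wp ≤ 1)
    (hwm0 : 0 ≤ wm) (hwm1 : wm ≤ 1)
    (hwpm0 : 0 ≤ wpm) (hwpm1 : wpm ≤ 1)
    (he1 : np + nm = n)
    (he2 : np * (np - 1) / 2 * wp + np * nm * wpm + nm * (nm - 1) / 2 * wm = d * n / 2)
    (hdp1 : d ≤ (np - 1) * wp + nm * wpm) (hdp2 : (np - 1) * wp + nm * wpm ≤ Δ)
    (hdm1 : 0 ≤ (nm - 1) * wm + np * wpm) (hdm2 : (nm - 1) * wm + np * wpm ≤ d) :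
    np * ((np - 1) * wp - d) + nm * (d - (nm - 1) * wm)
      ≤ max ((2 * Δ + 1 - Real.sqrt ((2 * Δ + 1) ^ 2 - 4 * d * n)) * (Δ - d))
            (d * (2 * n - 1 - Real.sqrt (4 * d * n + 1))) := by
  obtain ⟨s, hs⟩ : ∃ s, s = Real.sqrt ((2 * Δ + 1) ^ 2 - 4 * d * n) := ⟨_, rfl⟩
  obtain ⟨t, ht⟩ : ∃ t, t = Real.sqrt (4 * d * n + 1) := ⟨_, rfl⟩
  have hs2 : s ^ 2 = (2 * Δ + 1) ^ 2 - 4 * d * n := by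
    rw [hs]; exact Real.sq_sqrt (by nlinarith)
  have ht2 : t ^ 2 = 4 * d * n + 1 := by
    rw [ht]; exact Real.sq_sqrt (by nlinarith)
  rw [← hs, ← ht]
  obtain ⟨a, ha⟩ : ∃ a, a = (2 * Δ + 1 - s) / 2 := ⟨_, rfl⟩
  obtain ⟨b, hb⟩ : ∃ b, b = (1 + t) / 2 := ⟨_, rfl⟩
  have hsa : s = 2 * Δ + 1 - 2 * a := by linarith
  have htb : t = 2 * b - 1 := by linarith
  subst hsa htb
  have ha2 : a ^ 2 - (2 * Δ + 1) * a + d * n = 0 := by nlinarith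
  have hb2 : b ^ 2 - b = d * n := by nlinarith
  subst he1
  obtain ⟨F, hF⟩ : ∃ F, F = np * ((np - 1) * wp - d) + nm * (d - (nm - 1) * wm) := ⟨_, rfl⟩
  rw [← hF]
  have e1 : F = 2 * (np * ((np - 1) * wp + nm * wpm - d)) := by rw [hF]; linarith
  have e2 : F = 2 * (nm * (d - ((nm - 1) * wm + np * wpm))) := by rw [hF]; linarith
  have p1 : 0 ≤ nm * ((nm - 1) * wm) :=
    mul_nonneg (by linarith) (mul_nonneg (by linarith) hwm0)
  have p2 : 0 ≤ np * ((np - 1) * (1 - wp)) :=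
    mul_nonneg (by linarith) (mul_nonneg (by linarith) (by linarith))
  have b1 : F ≤ 2 * (np * (Δ - d)) := by
    rw [e1]
    have := mul_le_mul_of_nonneg_left hdp2 (show 0 ≤ np by linarith)
    linarith
  have b2 : F ≤ 2 * (nm * d) := by
    rw [e2]
    have := mul_nonneg (show 0 ≤ nm by linarith) hdm1
    linarith
  have b3 : F ≤ d * (np + nm) - 2 * d * np + np ^ 2 - np := by linarith
  rcases le_total np a with h | hpa
  · apply le_max_of_le_left
    have := mul_le_mul_of_nonneg_right h (show 0 ≤ Δ - d by linarith)
    linarith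
  rcases le_total b np with h | hpb
  · apply le_max_of_le_right
    have := mul_le_mul_of_nonneg_left h h0.le
    linarith
  rcases le_total 0 (np + a - 2 * d - 1) with h | h
  · apply le_max_of_le_right
    have := mul_nonneg (show 0 ≤ b - np by linarith)
      (show 0 ≤ np + b - 2 * d - 1 by linarith)
    linarith
  · apply le_max_of_le_left
    have := mul_nonneg (show 0 ≤ np - a by linarith)
      (show 0 ≤ -(np + a - 2 * d - 1) by linarith)
    linarith
end

section
/- Let n, d, s be real numbers with n > 0 and s > 0, and define f(n₊, x₊) = (1/(2(n−n₊)))·( √( (n/n₊)·( (d−x₊)((d−x₊)n + 2s)n₊ + s² ) ) + (d+x₊)n − 2dn₊ − s ). Then for all n₊ and x₊ with 0 < n₊ < n and 0 ≤ x₊ ≤ n₊, the derivative of the function x ↦ f(n₊, x) at x₊ is nonnegative. -/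
/-- The objective function `f(n₊, x₊)` of the optimization problem `(Q')`. -/
noncomputable def objQ (n d s np xp : ℝ) : ℝ :=
  (1 / (2 * (n - np))) *
    (Real.sqrt ((n / np) * ((d - xp) * ((d - xp) * n + 2 * s) * np + s ^ 2))
      + (d + xp) * n - 2 * d * np - s)

/-- For `n > 0`, `s > 0`, `0 < n₊ < n`, and `0 ≤ x₊ ≤ n₊`, the partial
derivative of `f` with respect to `x₊` is nonnegative. -/
theorem objQ_deriv_xp_nonneg (n d s : ℝ) (hn : 0 < n) (hs : 0 < s) :
    ∀ np xp : ℝ, 0 < np → np < n → 0 ≤ xp → xp ≤ np →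
      0 ≤ deriv (fun x => objQ n d s np x) xp := by
  intro np xp h0 h1 _ _
  have hR : ∀ x : ℝ, (n / np) * ((d - x) * ((d - x) * n + 2 * s) * np + s ^ 2)
      = (n * (d - x) + s) ^ 2 + s ^ 2 * ((n - np) / np) := by
    intro x
    field_simp
    ring
  have hc : 0 < s ^ 2 * ((n - np) / np) := by
    have : 0 < n - np := by linarith
    positivity
  have hpos : 0 < (n * (d - xp) + s) ^ 2 + s ^ 2 * ((n - np) / np) := by positivity
  have hlin : HasDerivAt (fun x : ℝ => n * (d - x) + s) (n * (-1)) xp :=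
    (((hasDerivAt_id' xp).const_sub d).const_mul n).add_const s
  have hsq := ((hlin.pow 2).add_const (s ^ 2 * ((n - np) / np))).sqrt hpos.ne'
  have hl2 : HasDerivAt (fun x : ℝ => (d + x) * n) (1 * n) xp :=
    ((hasDerivAt_id' xp).const_add d).mul_const n
  have hD := (((hsq.add hl2).sub_const (2 * d * np)).sub_const s).const_mul
    (1 / (2 * (n - np)))
  have hfun : (fun x => objQ n d s np x) = fun x => (1 / (2 * (n - np))) *
      (Real.sqrt ((n * (d - x) + s) ^ 2 + s ^ 2 * ((n - np) / np))
      + (d + x) * n - 2 * d * np - s) := by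
    funext x
    simp only [objQ, hR]
  rw [hfun]
  refine le_of_le_of_eq ?_ (HasDerivAt.deriv hD).symm
  have hle : n * (d - xp) + s ≤
      Real.sqrt ((n * (d - xp) + s) ^ 2 + s ^ 2 * ((n - np) / np)) :=
    Real.le_sqrt_of_sq_le (by linarith)
  have hsp := Real.sqrt_pos.2 hpos
  apply mul_nonneg
  · have : 0 < n - np := by linarith
    positivity
  · simp only [Pi.pow_apply]
    generalize Real.sqrt ((n * (d - xp) + s) ^ 2 + s ^ 2 * ((n - np) / np)) = q at *
    have : ((2 : ℕ) : ℝ) * (n * (d - xp) + s) ^ (2 - 1) * (n * (-1)) / (2 * q) + 1 * n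
        = n * (q - (n * (d - xp) + s)) / q := by
      field_simp
      push_cast
      ring
    rw [this]
    exact div_nonneg (mul_nonneg hn.le (by linarith)) hsp.le
end

section
/- Let n, d, s be real numbers with n > 0, d > 0, and s > 0, and define f(n₊, x₊) = (1/(2(n−n₊)))·( √( (n/n₊)·( (d−x₊)((d−x₊)n + 2s)n₊ + s² ) ) + (d+x₊)n − 2dn₊ − s ). Then for all n₊ with 0 < n₊ < n, the derivative of the function t ↦ f(t, 0) at n₊ is nonpositive. -/
/-- For `n > 0`, `d > 0`, `s > 0`, and `0 < n₊ < n`, the derivative of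
`t ↦ f(t, 0)` at `n₊` is nonpositive. -/
theorem objQ_deriv_np_at_zero_nonpos (n d s : ℝ) (hn : 0 < n) (hd : 0 < d) (hs : 0 < s) :
    ∀ np : ℝ, 0 < np → np < n →
      deriv (fun t => objQ n d s t 0) np ≤ 0 := by
  intro t ht htn
  have hnt : 0 < n - t := sub_pos.2 htn
  have hg : 0 < (n / t) * ((d - 0) * ((d - 0) * n + 2 * s) * t + s ^ 2) := by
    rw [sub_zero]; positivity
  have h1 : HasDerivAt (fun t : ℝ => (n / t) * ((d - 0) * ((d - 0) * n + 2 * s) * t + s ^ 2))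
      (-(n * s ^ 2) / t ^ 2) t := by
    have ha := ((hasDerivAt_const t n).div (hasDerivAt_id t) ht.ne').mul
      (((hasDerivAt_id t).const_mul ((d - 0) * ((d - 0) * n + 2 * s))).add_const (s ^ 2))
    refine ha.congr_deriv ?_
    simp only [id, Pi.div_apply]
    field_simp
    ring
  have h2 := h1.sqrt hg.ne'
  have h3 := ((h2.add_const ((d + 0) * n)).sub ((hasDerivAt_id t).const_mul (2 * d))).sub_const s
  have h4 := (hasDerivAt_const t (1 : ℝ)).div
    (((hasDerivAt_id t).const_sub n).const_mul 2) (by simpa using hnt.ne')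
  have h5 := h4.mul h3
  have h6 : deriv (fun t => objQ n d s t 0) t = _ := h5.deriv
  rw [h6]
  simp only [id, Pi.div_apply, Pi.sub_apply]
  have hR2 := Real.sq_sqrt hg.le
  have hR := Real.sqrt_pos.2 hg
  set R := √((n / t) * ((d - 0) * ((d - 0) * n + 2 * s) * t + s ^ 2)) with hRdef
  have e : R ^ 2 * t = n * (d * (d * n + 2 * s) * t + s ^ 2) := by
    rw [hR2]; field_simp; ring
  clear_value R
  have key1 : R * t ≤ n * (d * n + s) := by
    refine abs_le_of_sq_le_sq' ?_ (by positivity) |>.2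
    have : (R * t) ^ 2 = (R ^ 2 * t) * t := by ring
    rw [this, e]
    have hA : 0 < n * d * (d * n + 2 * s) := by positivity
    have hB : 0 < n * s ^ 2 := by positivity
    have : 0 < (n - t) * (n * d * (d * n + 2 * s) * (n + t) + n * s ^ 2) := by positivity
    nlinarith
  have key2 : 2 * t * R ≤ n * (R + (d * n + s)) := by nlinarith
  have e2 : (R - (d * n + s)) * (R + (d * n + s)) * t = s ^ 2 * (n - t) := by
    linear_combination e
  have hC : 0 < R + (d * n + s) := by positivity
  have key3 : 2 * t ^ 2 * R * (R - (d * n + s)) ≤ n * s ^ 2 * (n - t) := by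
    have : 0 ≤ (n * (R + (d * n + s)) - 2 * t * R) * (s ^ 2 * (n - t)) :=
      mul_nonneg (sub_nonneg.2 key2) (by positivity)
    refine le_of_mul_le_mul_right ?_ hC
    have e3 : 2 * t ^ 2 * R * (R - (d * n + s)) * (R + (d * n + s))
      = 2 * t * R * (s ^ 2 * (n - t)) := by rw [← e2]; ring
    rw [e3]; linarith
  have fin : (0 * (2 * (n - t)) - 1 * (2 * -1)) / (2 * (n - t)) ^ 2 *
        (R + (d + 0) * n - 2 * d * t - s) +
      1 / (2 * (n - t)) * (-(n * s ^ 2) / t ^ 2 / (2 * R) - 2 * d * 1)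
      = (2 * t ^ 2 * R * (R - (d * n + s)) - n * s ^ 2 * (n - t)) /
        (4 * t ^ 2 * R * (n - t) ^ 2) := by
    field_simp
    ring
  rw [fin]
  exact div_nonpos_of_nonpos_of_nonneg (by linarith) (by positivity)
end

section
/- Let n and s be real numbers with n > 0 and s > 0, and consider the cubic polynomial P(x) = −2n³ + 8n²x − 12nx² − ns + 8x³. Then P is strictly increasing on ℝ, P has a unique real zero p, and this zero satisfies n/2 + s/(2n) − s³/(2n⁵) < p < n/2 + s/(2n). -/
/-- For `n > 0` and `s > 0`, the cubic
`P(x) = −2n³ + 8n²x − 12nx² − ns + 8x³` is strictly increasing on `ℝ`, has a unique real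
zero `p`, and this zero satisfies `n/2 + s/(2n) − s³/(2n⁵) < p < n/2 + s/(2n)`. -/
theorem cubic_P_strictMono_unique_zero (n s : ℝ) (hn : 0 < n) (hs : 0 < s) :
    StrictMono (fun x : ℝ => -2 * n ^ 3 + 8 * n ^ 2 * x - 12 * n * x ^ 2 - n * s + 8 * x ^ 3) ∧
    ∃ p : ℝ, (-2 * n ^ 3 + 8 * n ^ 2 * p - 12 * n * p ^ 2 - n * s + 8 * p ^ 3 = 0) ∧
      (∀ q : ℝ, -2 * n ^ 3 + 8 * n ^ 2 * q - 12 * n * q ^ 2 - n * s + 8 * q ^ 3 = 0 → q = p) ∧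
      n / 2 + s / (2 * n) - s ^ 3 / (2 * n ^ 5) < p ∧ p < n / 2 + s / (2 * n) := by
  have hP : ∀ x : ℝ, -2 * n ^ 3 + 8 * n ^ 2 * x - 12 * n * x ^ 2 - n * s + 8 * x ^ 3
      = (2 * x - n) ^ 3 + n ^ 2 * (2 * x - n) - n * s := fun x => by ring
  have hmono : StrictMono
      (fun x : ℝ => -2 * n ^ 3 + 8 * n ^ 2 * x - 12 * n * x ^ 2 - n * s + 8 * x ^ 3) := by
    intro a b hab
    simp only [hP]
    have h1 : (2 * a - n) ^ 3 < (2 * b - n) ^ 3 :=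
      (Odd.strictMono_pow (by decide : Odd 3)) (by linarith)
    have h2 : n ^ 2 * (2 * a - n) < n ^ 2 * (2 * b - n) :=
      mul_lt_mul_of_pos_left (by linarith) (by positivity)
    linarith
  refine ⟨hmono, ?_⟩
  obtain ⟨u, hu⟩ : ∃ u, u = s / n ^ 2 := ⟨_, rfl⟩
  have hu0 : 0 < u := by rw [hu]; positivity
  have hsu : s = u * n ^ 2 := by rw [hu]; field_simp
  have e1 : n / 2 + s / (2 * n) = n / 2 + n * u / 2 := by rw [hsu]; field_simp
  have e2 : n / 2 + s / (2 * n) - s ^ 3 / (2 * n ^ 5) = n / 2 + n * (u - u ^ 3) / 2 := by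
    rw [hsu]; field_simp; ring
  rw [e2, e1]
  have hlo : -2 * n ^ 3 + 8 * n ^ 2 * (n / 2 + n * (u - u ^ 3) / 2)
      - 12 * n * (n / 2 + n * (u - u ^ 3) / 2) ^ 2 - n * s
      + 8 * (n / 2 + n * (u - u ^ 3) / 2) ^ 3 < 0 := by
    have h : 0 < n ^ 3 * u ^ 5 * ((u ^ 2 - 3 / 2) ^ 2 + 3 / 4) := by positivity
    rw [hP, hsu]
    linear_combination h
  have hhi : 0 < -2 * n ^ 3 + 8 * n ^ 2 * (n / 2 + n * u / 2)
      - 12 * n * (n / 2 + n * u / 2) ^ 2 - n * s + 8 * (n / 2 + n * u / 2) ^ 3 := by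
    have h : 0 < n ^ 3 * u ^ 3 := by positivity
    rw [hP, hsu]
    linear_combination h
  have hle : n / 2 + n * (u - u ^ 3) / 2 ≤ n / 2 + n * u / 2 := by
    have : 0 < n * u ^ 3 := by positivity
    linarith
  have hc : Continuous
      (fun x : ℝ => -2 * n ^ 3 + 8 * n ^ 2 * x - 12 * n * x ^ 2 - n * s + 8 * x ^ 3) := by
    fun_prop
  obtain ⟨p, hp, hp0⟩ := intermediate_value_Ioo hle hc.continuousOn ⟨hlo, hhi⟩
  exact ⟨p, hp0, fun q hq => hmono.injective (hq.trans hp0.symm), hp.1, hp.2⟩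
end

section
/- Let n, d, s be real numbers with n > 0, n/2 < d ≤ 4n/5, and 7n(d − n/2)/10 ≤ s ≤ n²/2. Define N = d/2 + n/2 − √(d² − 2dn + n² + 2s)/2, N₁ = d/2 + n/4 − s/(4n), and p₁ = n/2 + s/(2n) − s³/(2n⁵). Then N ≤ N₁ ≤ p₁. -/
/-- For `n > 0`, `n/2 < d ≤ 4n/5`, and `7n(d − n/2)/10 ≤ s ≤ n²/2`, with
`N = d/2 + n/2 − √(d² − 2dn + n² + 2s)/2`, `N₁ = d/2 + n/4 − s/(4n)`, and
`p₁ = n/2 + s/(2n) − s³/(2n⁵)`, we have `N ≤ N₁ ≤ p₁`. -/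
theorem N_le_N1_le_p1 (n d s : ℝ) (hn : 0 < n)
    (hd1 : n / 2 < d) (hd2 : d ≤ 4 * n / 5)
    (hs1 : 7 * n * (d - n / 2) / 10 ≤ s) (hs2 : s ≤ n ^ 2 / 2) :
    d / 2 + n / 2 - Real.sqrt (d ^ 2 - 2 * d * n + n ^ 2 + 2 * s) / 2
        ≤ d / 2 + n / 4 - s / (4 * n) ∧
    d / 2 + n / 4 - s / (4 * n) ≤ n / 2 + s / (2 * n) - s ^ 3 / (2 * n ^ 5) := by
  obtain ⟨t, rfl⟩ : ∃ t, s = t * n ^ 2 := ⟨s / n ^ 2, by field_simp⟩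
  obtain ⟨x, rfl⟩ : ∃ x, d = (x + 1 / 2) * n := ⟨d / n - 1 / 2, by field_simp; ring⟩
  have hn2 : 0 < n ^ 2 := by positivity
  have hx0 : 0 < x := by
    by_contra h
    nlinarith
  have hx1 : x ≤ 3 / 10 := by
    by_contra h
    nlinarith
  have ht0 : 7 * x / 10 ≤ t := by
    by_contra h
    nlinarith
  have ht1 : t ≤ 1 / 2 := by
    by_contra h
    nlinarith
  have htp : 0 < t := by linarith
  have e1 : t * n ^ 2 / (4 * n) = t * n / 4 := by field_simp
  have e2 : t * n ^ 2 / (2 * n) = t * n / 2 := by field_simp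
  have e3 : (t * n ^ 2) ^ 3 / (2 * n ^ 5) = t ^ 3 * n / 2 := by field_simp
  rw [e1, e2, e3]
  constructor
  · have key : 0 ≤ 3 / 2 * t - t ^ 2 / 4 - x + x ^ 2 := by
      nlinarith [mul_nonneg (sub_nonneg.2 ht0) (sub_nonneg.2 ht1),
        mul_nonneg (sub_nonneg.2 ht0) hx0.le, sq_nonneg x]
    have : n * (1 + t) / 2 ≤ Real.sqrt (((x + 1 / 2) * n) ^ 2 - 2 * ((x + 1 / 2) * n) * n + n ^ 2 + 2 * (t * n ^ 2)) := by
      apply Real.le_sqrt_of_sq_le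
      nlinarith [mul_nonneg hn2.le key]
    linarith
  · have key : 0 ≤ 3 / 2 * t - t ^ 3 - x := by
      rcases le_total t (6 / 25) with h | h
      · have h2 : t ^ 2 ≤ (6 / 25) ^ 2 := by gcongr
        nlinarith [mul_le_mul_of_nonneg_left h2 htp.le]
      · have h2 : t ^ 2 ≤ (1 / 2) ^ 2 := by gcongr
        nlinarith [mul_le_mul_of_nonneg_left h2 htp.le]
    nlinarith [mul_nonneg hn.le key]
end

section
/- Let n and s be real numbers with n > 0 and 0 < s < n²/2. Then √(n⁸ + 6n⁴s² − 3s⁴) ≥ n⁴ + 3s² − 6s⁴/n⁴ + 18s⁶/n⁸ − 72s⁸/n¹². -/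
/-- For `n > 0` and `0 < s < n²/2`,
`√(n⁸ + 6n⁴s² − 3s⁴) ≥ n⁴ + 3s² − 6s⁴/n⁴ + 18s⁶/n⁸ − 72s⁸/n¹²`. -/
theorem sqrt_lower_bound_taylor (n s : ℝ) (hn : 0 < n) (hs0 : 0 < s) (hs1 : s < n ^ 2 / 2) :
    Real.sqrt (n ^ 8 + 6 * n ^ 4 * s ^ 2 - 3 * s ^ 4)
      ≥ n ^ 4 + 3 * s ^ 2 - 6 * s ^ 4 / n ^ 4 + 18 * s ^ 6 / n ^ 8 - 72 * s ^ 8 / n ^ 12 := by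
  obtain ⟨x, hx⟩ : ∃ x, x = s ^ 2 / n ^ 4 := ⟨_, rfl⟩
  have hx0 : 0 < x := by rw [hx]; positivity
  have hx1 : x < 1 / 4 := by
    rw [hx, div_lt_iff₀ (by positivity)]
    nlinarith
  have key : n ^ 4 + 3 * s ^ 2 - 6 * s ^ 4 / n ^ 4 + 18 * s ^ 6 / n ^ 8 - 72 * s ^ 8 / n ^ 12
      = n ^ 4 * (1 + 3 * x - 6 * x ^ 2 + 18 * x ^ 3 - 72 * x ^ 4) := by
    rw [hx]; field_simp
  have key2 : n ^ 8 + 6 * n ^ 4 * s ^ 2 - 3 * s ^ 4 = n ^ 8 * (1 + 6 * x - 3 * x ^ 2) := by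
    rw [hx]; field_simp
  rw [key, key2]
  refine le_trans (le_abs_self _) (Real.abs_le_sqrt ?_)
  have h3 : 0 ≤ 648 - 1188 * x + 2592 * x ^ 2 - 5184 * x ^ 3 := by
    have : 0 ≤ x ^ 2 * (1 / 4 - x) := mul_nonneg (by positivity) (by linarith)
    nlinarith [sq_nonneg x]
  have h4 : 0 ≤ n ^ 8 * (x ^ 5 * (648 - 1188 * x + 2592 * x ^ 2 - 5184 * x ^ 3)) := by
    positivity
  linarith [h4]
end

section
/- Let n, d, s be real numbers with n > 0, n/2 < d ≤ n, and 0 < s ≤ 0.35n². Define f₂ = ( dn¹⁵ − dn¹¹s² + n¹²s² − 3n⁸s⁴ + 9n⁴s⁶ − 36s⁸ ) / ( n³( n¹² − n⁸s² + 2n⁴s⁴ − s⁶ ) ) and f₃ = d + s²/n³ − 2(d+n)s⁴/n⁸. Then f₂ ≥ f₃. -/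
/-- For `n > 0`, `n/2 < d ≤ n`, and `0 < s ≤ 0.35n²`, with
`f₂ = (dn¹⁵ − dn¹¹s² + n¹²s² − 3n⁸s⁴ + 9n⁴s⁶ − 36s⁸)/(n³(n¹² − n⁸s² + 2n⁴s⁴ − s⁶))` and
`f₃ = d + s²/n³ − 2(d+n)s⁴/n⁸`, we have `f₂ ≥ f₃`. -/
theorem f2_ge_f3 (n d s : ℝ) (hn : 0 < n) (hd1 : n / 2 < d) (hd2 : d ≤ n)
    (hs0 : 0 < s) (hs1 : s ≤ 0.35 * n ^ 2) :
    (d * n ^ 15 - d * n ^ 11 * s ^ 2 + n ^ 12 * s ^ 2 - 3 * n ^ 8 * s ^ 4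
        + 9 * n ^ 4 * s ^ 6 - 36 * s ^ 8)
      / (n ^ 3 * (n ^ 12 - n ^ 8 * s ^ 2 + 2 * n ^ 4 * s ^ 4 - s ^ 6))
    ≥ d + s ^ 2 / n ^ 3 - 2 * (d + n) * s ^ 4 / n ^ 8 := by
  have ht : s ^ 2 ≤ 0.1225 * n ^ 4 := by
    have := mul_self_le_mul_self hs0.le hs1
    nlinarith
  have ht0 : 0 < s ^ 2 := by positivity
  have hN : 0 < n ^ 4 := by positivity
  have hD : 0 < n ^ 12 - n ^ 8 * s ^ 2 + 2 * n ^ 4 * s ^ 4 - s ^ 6 := by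
    have e : n ^ 12 - n ^ 8 * s ^ 2 + 2 * n ^ 4 * s ^ 4 - s ^ 6
        = n ^ 8 * (n ^ 4 - s ^ 2) + s ^ 4 * (2 * n ^ 4 - s ^ 2) := by ring
    have h1 : 0 < n ^ 4 - s ^ 2 := by linarith
    have h2 : 0 < 2 * n ^ 4 - s ^ 2 := by linarith
    rw [e]; positivity
  have hK : 0 ≤ d * (-n ^ 8 + 4 * n ^ 4 * s ^ 2 - 2 * s ^ 4)
      + n * (5 * n ^ 8 - 31 * n ^ 4 * s ^ 2 - 2 * s ^ 4) := by
    have h1 : 0 ≤ n ^ 8 - 4 * n ^ 4 * s ^ 2 + 2 * s ^ 4 := by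
      have e : n ^ 8 - 4 * n ^ 4 * s ^ 2 + 2 * s ^ 4
        = n ^ 4 * (n ^ 4 - 4 * s ^ 2) + 2 * s ^ 4 := by ring
      have : 0 ≤ n ^ 4 - 4 * s ^ 2 := by linarith
      rw [e]; positivity
    have h2 : 0 ≤ 4 * n ^ 8 - 27 * n ^ 4 * s ^ 2 - 4 * s ^ 4 := by
      have e : 4 * n ^ 8 - 27 * n ^ 4 * s ^ 2 - 4 * s ^ 4
        = n ^ 4 * (4 * n ^ 4 - 28 * s ^ 2) + s ^ 2 * (n ^ 4 - 4 * s ^ 2) := by ring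
      have : 0 ≤ n ^ 4 - 4 * s ^ 2 := by linarith
      have : 0 ≤ 4 * n ^ 4 - 28 * s ^ 2 := by linarith
      rw [e]; positivity
    have h3 := mul_nonneg (sub_nonneg.2 hd2) h1
    have h4 := mul_nonneg hn.le h2
    linarith
  have key : (d * n ^ 15 - d * n ^ 11 * s ^ 2 + n ^ 12 * s ^ 2 - 3 * n ^ 8 * s ^ 4
        + 9 * n ^ 4 * s ^ 6 - 36 * s ^ 8)
      / (n ^ 3 * (n ^ 12 - n ^ 8 * s ^ 2 + 2 * n ^ 4 * s ^ 4 - s ^ 6))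
    - (d + s ^ 2 / n ^ 3 - 2 * (d + n) * s ^ 4 / n ^ 8)
    = s ^ 6 * (d * (-n ^ 8 + 4 * n ^ 4 * s ^ 2 - 2 * s ^ 4)
      + n * (5 * n ^ 8 - 31 * n ^ 4 * s ^ 2 - 2 * s ^ 4)) /
      (n ^ 8 * (n ^ 12 - n ^ 8 * s ^ 2 + 2 * n ^ 4 * s ^ 4 - s ^ 6)) := by
    have hD' := hD.ne'
    generalize hE : n ^ 12 - n ^ 8 * s ^ 2 + 2 * n ^ 4 * s ^ 4 - s ^ 6 = E at *
    field_simp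
    rw [← hE]
    ring
  have : 0 ≤ s ^ 6 * (d * (-n ^ 8 + 4 * n ^ 4 * s ^ 2 - 2 * s ^ 4)
      + n * (5 * n ^ 8 - 31 * n ^ 4 * s ^ 2 - 2 * s ^ 4)) /
      (n ^ 8 * (n ^ 12 - n ^ 8 * s ^ 2 + 2 * n ^ 4 * s ^ 4 - s ^ 6)) := by
    positivity
  linarith
end
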